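/- arXiv:1810.10562 — 5 statements merged into one kernel-verified Lean document; each statement's English description precedes it below -/
import Mathlib

section
/- Let k, n be integers with 2 ≤ k ≤ n/2, let R be a commutative ring, and let M be a k × n matrix over R. Let r ∈ ℤ/nℤ, let 1 ≤ s ≤ k, and let m_1, …, m_s ∈ ℤ/nℤ satisfy: (c1) there exists b ∈ {1,…,s} such that, comparing representatives in {1,…,n}, m_b < m_{b+1} < … < m_s < m_1 < m_2 < … < m_{b−1}; and (c2) r+k−2 does not lie in the cyclic half-open interval [m_1, m_s). Then the determinant of the s × s matrix whose (i,j) entry (1 ≤ i,j ≤ s) is P([r+i−1]^{k−1} ∪ {m_j}) equals (∏_{l=0}^{s−2} P([r+l]^k)) · P([r+s−1]^{k−s} ∪ {m_1, …, m_s}). -/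
/-- Representative of `x : ZMod n` in `{1, …, n}`. -/
def rep (n : ℕ) (x : ZMod n) : ℕ := if x.val = 0 then n else x.val

/-- The cyclic segment `[r]^ℓ = {r, r+1, …, r+ℓ-1}` in `ZMod n`. -/
def cSeg (n : ℕ) (r : ZMod n) (ℓ : ℕ) : Finset (ZMod n) :=
  (Finset.range ℓ).image (fun t : ℕ => r + (t : ZMod n))

/-- The cyclic closed interval `[a,b] = {a, a+1, …, b}` in `ZMod n`. -/
def cIcc (n : ℕ) (a b : ZMod n) : Finset (ZMod n) := cSeg n a ((b - a).val + 1)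

/-- The Plücker coordinate `P(I)`: the determinant of the `k × k` submatrix of `M` on the
columns indexed by `I`, taken in increasing order of the representatives in `{1,…,n}`;
it is `0` if `I` is not a `k`-subset. -/
noncomputable def pluck {R : Type*} [CommRing R] {k n : ℕ}
    (M : Matrix (Fin k) (ZMod n) R) (I : Finset (ZMod n)) : R :=
  if h : (I.image (rep n)).card = k ∧ I.card = k then
    Matrix.det (Matrix.of fun i j : Fin k =>
      M i ((((I.image (rep n)).orderIsoOfFin h.1 j : ℕ) : ZMod n)))
  else 0


/-- The cyclic half-open interval `[a,b) = [a,b] ∖ {b}` in `ZMod n`. -/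
def cIco (n : ℕ) (a b : ZMod n) : Finset (ZMod n) := (cIcc n a b).erase b

open Matrix in
theorem updRow_det {R : Type*} [CommRing R] {k : ℕ} (W : Matrix (Fin k) (Fin k) R) (a : Fin k)
    (x : Fin k → R) : (W.updateRow a x).det = ∑ c, W.adjugate c a * x c := by
  rw [← Matrix.cramer_transpose_apply, Matrix.cramer_eq_adjugate_mulVec, ← Matrix.adjugate_transpose]
  simp [Matrix.mulVec, dotProduct]

/-- the window matrix -/
def winM {R : Type*} {k : ℕ} (w : ℕ → Fin k → R) (i : ℕ) : Matrix (Fin k) (Fin k) R :=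
  Matrix.of fun t => w (i + t)

/-- window with appended vectors -/
def appM {R : Type*} {p s : ℕ} (w : ℕ → Fin (p + s) → R) (u : Fin s → Fin (p + s) → R) :
    Matrix (Fin (p + s)) (Fin (p + s)) R :=
  Matrix.of fun t => Fin.addCases (fun a => w (s - 1 + a)) (fun j => u j) t

theorem alg_block {R : Type*} [CommRing R] {p s : ℕ} (hs : 1 ≤ s) (w : ℕ → Fin (p + s) → R) :
    ∃ g : R, ∀ u : Fin s → Fin (p + s) → R,
      g * (appM w u).det = (winM w (s - 1)).det ^ p *
        Matrix.det (Matrix.of fun i j : Fin s =>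
          ((winM w i).updateRow ⟨p + s - 1, by omega⟩ (u j)).det) := by
  classical
  let G : Matrix (Fin (p + s)) (Fin (p + s)) R := Matrix.of fun a =>
    Fin.addCases (fun a => fun c => (winM w (s - 1)).adjugate c (Fin.castAdd s a))
      (fun i : Fin s => fun c => (winM w i).adjugate c ⟨p + s - 1, by omega⟩) a
  refine ⟨G.det, fun u => ?_⟩
  rw [← Matrix.det_transpose (appM w u), ← Matrix.det_mul,
    ← Matrix.det_submatrix_equiv_self finSumFinEquiv]
  have : (G * (appM w u).transpose).submatrix finSumFinEquiv finSumFinEquiv =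
      Matrix.fromBlocks ((winM w (s - 1)).det • (1 : Matrix (Fin p) (Fin p) R))
        (Matrix.of fun a j => ((winM w (s-1)).updateRow (Fin.castAdd s a) (u j)).det) 0
        (Matrix.of fun i j : Fin s =>
          ((winM w i).updateRow ⟨p + s - 1, by omega⟩ (u j)).det) := by
    ext a b
    rcases a with a | i <;> rcases b with b | j
    · simp only [Matrix.submatrix_apply, Matrix.mul_apply, G, appM, finSumFinEquiv_apply_left,
        Matrix.of_apply, Matrix.transpose_apply, Fin.addCases_left, Matrix.fromBlocks_apply₁₁]
      rw [← updRow_det]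
      by_cases hab : a = b
      · subst hab
        have : w (s - 1 + a) = winM w (s - 1) (Fin.castAdd s a) := by
          ext; simp [winM]
        rw [this, Matrix.updateRow_eq_self]
        simp
      · have : w (s - 1 + b) = winM w (s - 1) (Fin.castAdd s b) := by
          ext; simp [winM]
        rw [this, Matrix.det_updateRow_eq_zero]
        · simp [hab]
        · simpa [Fin.ext_iff, eq_comm] using hab
    · simp only [Matrix.submatrix_apply, Matrix.mul_apply, G, appM, finSumFinEquiv_apply_left,
        finSumFinEquiv_apply_right, Fin.addCases_right,
        Matrix.of_apply, Matrix.transpose_apply, Fin.addCases_left, Matrix.fromBlocks_apply₁₂]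
      rw [← updRow_det]
    · simp only [Matrix.submatrix_apply, Matrix.mul_apply, G, appM, finSumFinEquiv_apply_left,
        finSumFinEquiv_apply_right, Fin.addCases_right,
        Matrix.of_apply, Matrix.transpose_apply, Fin.addCases_left, Matrix.fromBlocks_apply₂₁]
      rw [← updRow_det]
      have : w (s - 1 + b) = winM w i ⟨s - 1 + b - i, by omega⟩ := by
        ext; simp only [winM, Matrix.of_apply]; congr 1; omega
      rw [this, Matrix.det_updateRow_eq_zero]
      · simp
      · simp only [ne_eq, Fin.mk.injEq]; omega
    · simp only [Matrix.submatrix_apply, Matrix.mul_apply, G, appM, 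
        finSumFinEquiv_apply_right, Fin.addCases_right,
        Matrix.of_apply, Matrix.transpose_apply, Matrix.fromBlocks_apply₂₂]
      rw [← updRow_det]
  rw [this, Matrix.det_fromBlocks_zero₂₁]
  simp

theorem alg_reg {R : Type*} [CommRing R] {p s : ℕ} (hs : 1 ≤ s) (w : ℕ → Fin (p + s) → R)
    (hreg : IsRegular (winM w (s - 1)).det) (u : Fin s → Fin (p + s) → R) :
    Matrix.det (Matrix.of fun i j : Fin s =>
          ((winM w i).updateRow ⟨p + s - 1, by omega⟩ (u j)).det) =
      (∏ l ∈ Finset.range (s - 1), (winM w l).det) * (appM w u).det := by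
  obtain ⟨g, hg⟩ := alg_block hs w
  have h1 := hg (fun j => w (p + s - 1 + j))
  have e1 : appM w (fun j => w (p + s - 1 + j)) = winM w (s - 1) := by
    ext t c
    refine Fin.addCases (fun a => ?_) (fun j => ?_) t
    · simp [appM, winM]
    · simp only [appM, winM, Matrix.of_apply, Fin.addCases_right, Fin.val_natAdd]
      congr 1; omega
  rw [e1, Matrix.det_of_isUpperTriangular (M := Matrix.of _)] at h1
  · simp only [Matrix.of_apply] at h1
    have e2 : ∀ i : Fin s, ((winM w i).updateRow ⟨p + s - 1, by omega⟩ (w (p + s - 1 + i))).det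
        = (winM w i).det := by
      intro i
      have : w (p + s - 1 + i) = winM w i ⟨p + s - 1, by omega⟩ := by
        ext; simp only [winM, Matrix.of_apply]; congr 1; omega
      rw [this, Matrix.updateRow_eq_self]
    simp only [e2] at h1
    rw [Fin.prod_univ_eq_prod_range (fun i => (winM w i).det) s] at h1
    obtain ⟨q, rfl⟩ : ∃ q, s = q + 1 := ⟨s - 1, by omega⟩
    simp only [Nat.add_sub_cancel] at *
    rw [Finset.prod_range_succ, ← mul_assoc] at h1
    have h2 := hreg.right h1
    have h3 := hg u
    rw [h2, mul_assoc] at h3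
    exact ((hreg.pow p).left h3).symm
  · intro i j hij
    simp only [id] at hij
    have : w (p + s - 1 + j) = winM w i ⟨p + s - 1 + j - i, by omega⟩ := by
      ext; simp only [winM, Matrix.of_apply]; congr 1; omega
    rw [Matrix.of_apply, this, Matrix.det_updateRow_eq_zero]
    simp only [ne_eq, Fin.mk.injEq]; omega

open Polynomial in
theorem alg_main {R : Type*} [CommRing R] {p s : ℕ} (hs : 1 ≤ s) (w : ℕ → Fin (p + s) → R)
    (u : Fin s → Fin (p + s) → R) :
    Matrix.det (Matrix.of fun i j : Fin s =>
          ((winM w i).updateRow ⟨p + s - 1, by omega⟩ (u j)).det) =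
      (∏ l ∈ Finset.range (s - 1), (winM w l).det) * (appM w u).det := by
  let w' : ℕ → Fin (p + s) → R[X] := fun i c => C (w i c) + if i = s - 1 + c then X else 0
  let u' : Fin s → Fin (p + s) → R[X] := fun j c => C (u j c)
  have hreg : IsRegular (winM w' (s - 1)).det := by
    have : winM w' (s - 1) = (-(winM w (s-1))).charmatrix := by
      ext1 a b
      simp only [winM, w', Matrix.of_apply, Matrix.charmatrix_apply, Matrix.neg_apply,
        Matrix.diagonal_apply]
      by_cases h : a = b
      · subst h; simp [add_comm]
      · have : (a : ℕ) ≠ b := by simpa [Fin.ext_iff] using h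
        simp [h, this]
    rw [this]
    exact (Matrix.charpoly_monic _).isRegular
  have h := congrArg (Polynomial.evalRingHom (0 : R)) (alg_reg hs w' hreg u')
  have ew : ∀ i, (Polynomial.evalRingHom (0 : R)).mapMatrix (winM w' i) = winM w i := by
    intro i; ext a b
    simp only [winM, w', RingHom.mapMatrix_apply, Matrix.map_apply, Matrix.of_apply]
    split_ifs <;> simp
  have ea : (Polynomial.evalRingHom (0 : R)).mapMatrix (appM w' u') = appM w u := by
    ext a b
    simp only [appM, RingHom.mapMatrix_apply, Matrix.map_apply, Matrix.of_apply]
    refine Fin.addCases (fun a => ?_) (fun j => ?_) a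
    · simp only [Fin.addCases_left, w']; split_ifs <;> simp
    · simp [u']
  rw [map_mul, map_prod, RingHom.map_det, RingHom.map_det, ea] at h
  simp only [RingHom.map_det, ew] at h
  rw [← h]
  congr 1
  ext i j
  simp only [RingHom.mapMatrix_apply, Matrix.map_apply, Matrix.of_apply]
  rw [RingHom.map_det, RingHom.mapMatrix_apply, Matrix.map_updateRow,
    ← RingHom.mapMatrix_apply, ew]
  congr 2
  ext c; simp [u']

/-- twisted columns -/
def twc {R : Type*} [CommRing R] {k n : ℕ} (M : Matrix (Fin k) (ZMod n) R) (t : ℤ) : Fin k → R :=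
  fun i => (((((-1 : ℤˣ) ^ (k - 1)) ^ ((t - 1) / (n : ℤ)) : ℤˣ) : ℤ) : R) * M i (t : ZMod n)

theorem twc_add {R : Type*} [CommRing R] {k n : ℕ} (hn : 0 < n) (M : Matrix (Fin k) (ZMod n) R)
    (t z : ℤ) : twc M (t + n * z) =
      (((((-1 : ℤˣ) ^ (k - 1)) ^ z : ℤˣ) : ℤ) : R) • twc M t := by
  have h : (t + n * z - 1) / (n : ℤ) = (t - 1) / n + z := by
    rw [show t + n * z - 1 = t - 1 + n * z by ring, Int.add_mul_ediv_left _ _ (by omega)]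
  funext i
  simp only [twc, h, zpow_add, Pi.smul_apply, smul_eq_mul]
  push_cast
  simp
  ring

theorem twc_base {R : Type*} [CommRing R] {k n : ℕ} (M : Matrix (Fin k) (ZMod n) R)
    (t : ℤ) (h1 : 1 ≤ t) (h2 : t ≤ n) : twc M t = fun i => M i (t : ZMod n) := by
  have h : (t - 1) / (n : ℤ) = 0 := Int.ediv_eq_zero_of_lt (by omega) (by omega)
  funext i
  simp [twc, h]

theorem rot_step {R : Type*} [CommRing R] {k n : ℕ} (hn : 0 < n) (hk : 0 < k)
    (M : Matrix (Fin k) (ZMod n) R)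
    (σ : ℤ → ℤ) (hσ : ∀ x, σ (x + k) = σ x + n) (q : ℤ) :
    Matrix.det (Matrix.of fun t : Fin k => twc M (σ (q + 1 + t))) =
      Matrix.det (Matrix.of fun t : Fin k => twc M (σ (q + t))) := by
  obtain ⟨k, rfl⟩ : ∃ j, k = j + 1 := ⟨k - 1, by omega⟩
  set A := (Matrix.of fun t : Fin (k + 1) => twc M (σ (q + t))) with hA
  have : (Matrix.of fun t : Fin (k + 1) => twc M (σ (q + 1 + t))) =
      (A.submatrix (finRotate (k + 1)) id).updateRow (Fin.last k)
        (((-1 : R) ^ k) • (A.submatrix (finRotate (k + 1)) id) (Fin.last k)) := by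
    ext t c
    by_cases ht : t = Fin.last k
    · subst ht
      rw [Matrix.updateRow_self]
      have e : σ (q + 1 + (Fin.last k : ℕ)) = σ q + n * 1 := by
        rw [mul_one, ← hσ]; congr 1; simp; ring
      rw [Matrix.of_apply, e, twc_add hn]
      simp [A]
    · rw [Matrix.updateRow_ne ht]
      simp only [Matrix.of_apply, Matrix.submatrix_apply, hA, coe_finRotate_of_ne_last ht, id]
      congr 2
      push_cast; ring
  rw [this, Matrix.det_updateRow_smul, Matrix.updateRow_eq_self, Matrix.det_permute,
    sign_finRotate]
  simp [← mul_assoc, ← mul_pow]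

theorem rot_all {R : Type*} [CommRing R] {k n : ℕ} (hn : 0 < n) (hk : 0 < k)
    (M : Matrix (Fin k) (ZMod n) R)
    (σ : ℤ → ℤ) (hσ : ∀ x, σ (x + k) = σ x + n) (q : ℤ) :
    Matrix.det (Matrix.of fun t : Fin k => twc M (σ (q + t))) =
      Matrix.det (Matrix.of fun t : Fin k => twc M (σ t)) := by
  induction q with
  | zero => simp
  | succ i ih => rw [← ih]; exact rot_step hn hk M σ hσ i
  | pred i ih =>
    rw [← ih, ← rot_step hn hk M σ hσ]
    simp

theorem rep_bounds {n : ℕ} (hn : 0 < n) (x : ZMod n) :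
    1 ≤ rep n x ∧ rep n x ≤ n ∧ ((rep n x : ℕ) : ZMod n) = x := by
  have : NeZero n := ⟨by omega⟩
  have := ZMod.val_lt x
  unfold rep
  split_ifs with h
  · refine ⟨hn, le_rfl, ?_⟩
    rw [ZMod.val_eq_zero] at h
    simp [h]
  · refine ⟨by omega, by omega, ?_⟩
    exact ZMod.natCast_zmod_val x

theorem cast_eq_iff {n : ℕ} (a b : ℤ) : (a : ZMod n) = b ↔ ∃ z, b = a + n * z := by
  rw [ZMod.intCast_eq_intCast_iff_dvd_sub]
  constructor
  · rintro ⟨z, hz⟩; exact ⟨z, by linarith⟩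
  · rintro ⟨z, hz⟩; exact ⟨z, by linarith⟩

theorem rep_cast {n : ℕ} (t : ℤ) (h1 : 1 ≤ t) (h2 : t ≤ n) :
    rep n (t : ZMod n) = t.toNat := by
  obtain ⟨a, b, c⟩ := rep_bounds (n := n) (by omega) (t : ZMod n)
  have : ((rep n (t : ZMod n) : ℤ) : ZMod n) = t := by exact_mod_cast c
  obtain ⟨z, hz⟩ := (cast_eq_iff _ _).1 this
  have : z = 0 := by
    have : -1 < z := by
      by_contra h
      nlinarith
    have : z < 1 := by
      by_contra h
      nlinarith
    omega
  subst this
  omega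

theorem pluck_base {R : Type*} [CommRing R] {k n : ℕ}
    (M : Matrix (Fin k) (ZMod n) R) (τ : Fin k → ℤ) (hm : StrictMono τ)
    (hb : ∀ t, 1 ≤ τ t ∧ τ t ≤ n) :
    pluck M (Finset.univ.image fun t => (τ t : ZMod n)) =
      Matrix.det (Matrix.of fun t : Fin k => twc M (τ t)) := by
  have him : ((Finset.univ.image fun t => (τ t : ZMod n)).image (rep n)) =
      Finset.univ.image (fun t => (τ t).toNat) := by
    rw [Finset.image_image]
    apply Finset.image_congr
    intro t _
    exact rep_cast _ (hb t).1 (hb t).2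
  have hm' : StrictMono (fun t => (τ t).toNat) := by
    intro a b h
    have := hm h
    have := hb a
    simp only
    omega
  have hc : ((Finset.univ.image fun t => (τ t : ZMod n)).image (rep n)).card = k := by
    rw [him, Finset.card_image_of_injective _ hm'.injective]; simp
  have hc2 : (Finset.univ.image fun t => (τ t : ZMod n)).card = k := by
    apply le_antisymm
    · exact Finset.card_image_le.trans (by simp)
    · conv_lhs => rw [← hc]
      exact Finset.card_image_le
  unfold pluck
  rw [dif_pos ⟨hc, hc2⟩, ← Matrix.det_transpose]
  congr 1
  ext t c
  have := Finset.orderEmbOfFin_unique hc (f := fun t => (τ t).toNat) (by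
    intro x; rw [him]; simp) hm'
  have h2 := congrFun this t
  simp only [Matrix.transpose_apply, Matrix.of_apply, Finset.coe_orderIsoOfFin_apply]
  rw [← h2, twc_base M _ (hb t).1 (hb t).2]
  congr 1
  have := hb t
  have e : ((τ t).toNat : ℤ) = τ t := by omega
  conv_rhs => rw [← e]
  rw [Int.cast_natCast]

theorem pluck_sm {R : Type*} [CommRing R] {k n : ℕ} (hn : 0 < n) (hk : 0 < k)
    (M : Matrix (Fin k) (ZMod n) R) (τ : Fin k → ℤ) (hm : StrictMono τ)
    (hb : ∀ t t', τ t < τ t' + n) :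
    pluck M (Finset.univ.image fun t => (τ t : ZMod n)) =
      Matrix.det (Matrix.of fun t : Fin k => twc M (τ t)) := by
  have hk' : (0 : ℤ) < k := by exact_mod_cast hk
  let σ : ℤ → ℤ := fun x => τ ⟨(x % k).toNat, by
    have := Int.emod_nonneg x hk'.ne'
    have := Int.emod_lt_of_pos x hk'
    omega⟩ + n * (x / k)
  have hσ : ∀ x, σ (x + k) = σ x + n := by
    intro x
    have e1 : (x + k) % k = x % k := by simp
    have e2 : (x + k) / k = x / k + 1 := by
      rw [Int.add_ediv_of_dvd_right (dvd_refl _), Int.ediv_self hk'.ne']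
    simp only [σ, e1, e2]; ring
  have hστ : ∀ t : Fin k, σ t = τ t := by
    intro t
    have e1 : ((t : ℕ) : ℤ) % k = t := Int.emod_eq_of_lt (by omega) (by omega)
    have e2 : ((t : ℕ) : ℤ) / k = 0 := Int.ediv_eq_zero_of_lt (by omega) (by omega)
    simp only [σ, e1, e2]; simp
  have hσk : ∀ x z, σ (x + k * z) = σ x + n * z := by
    intro x z
    have e1 : (x + k * z) % k = x % k := by simp
    have e2 : (x + k * z) / k = x / k + z := by
      rw [Int.add_mul_ediv_left _ _ hk'.ne']
    simp only [σ, e1, e2]; ring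
  have hσm : StrictMono σ := by
    apply strictMono_int_of_lt_succ
    intro x
    obtain ⟨t, z, hx⟩ : ∃ (t : Fin k) (z : ℤ), x = t + k * z := by
      have := Int.emod_nonneg x hk'.ne'
      have := Int.emod_lt_of_pos x hk'
      refine ⟨⟨(x % k).toNat, by omega⟩, x / k, ?_⟩
      have := Int.emod_add_mul_ediv x k
      simp only; omega
    by_cases ht : (t : ℕ) + 1 < k
    · have e : x + 1 = ((⟨t + 1, ht⟩ : Fin k) : ℕ) + k * z := by rw [hx]; push_cast; ring
      rw [e, hx, hσk, hσk, hστ, hστ]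
      have : τ t < τ ⟨t + 1, ht⟩ := hm (by simp [Fin.lt_def])
      omega
    · have e : x + 1 = ((⟨0, hk⟩ : Fin k) : ℕ) + k * (z + 1) := by
        have : (t : ℕ) + 1 = k := by omega
        rw [hx, mul_add]; push_cast; omega
      rw [e, hx, hσk, hσk, hστ, hστ]
      have := hb t ⟨0, hk⟩
      linarith
  obtain ⟨q, hq1, hq2⟩ : ∃ q, 0 < σ q ∧ ∀ z, 0 < σ z → q ≤ z := by
    apply Int.exists_least_of_bdd
    · refine ⟨-k * (|σ 0| + 1), fun z hz => ?_⟩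
      apply hσm.le_iff_le.1
      have := hσk 0 (-(|σ 0| + 1))
      rw [show -(k : ℤ) * (|σ 0| + 1) = 0 + k * (-(|σ 0| + 1)) by ring, this]
      have : σ 0 ≤ |σ 0| := le_abs_self _
      nlinarith [abs_nonneg (σ 0)]
    · refine ⟨0 + k * (|σ 0| + 1), ?_⟩
      rw [hσk]
      have : -|σ 0| ≤ σ 0 := neg_abs_le _
      nlinarith [abs_nonneg (σ 0)]
  have hq3 : σ (q + k - 1) ≤ n := by
    rw [show q + k - 1 = q - 1 + k by ring, hσ]
    have : ¬ 0 < σ (q - 1) := fun h => by have := hq2 _ h; omega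
    omega
  have hbase := pluck_base M (fun t : Fin k => σ (q + t)) (by
      intro a b h; apply hσm; have : (a : ℕ) < b := h; omega) (by
      intro t
      have h1 : σ q ≤ σ (q + t) := hσm.monotone (by omega)
      have h2 : σ (q + t) ≤ σ (q + k - 1) := hσm.monotone (by omega)
      omega)
  rw [rot_all hn hk M σ hσ] at hbase
  simp only [hστ] at hbase
  rw [← hbase]
  congr 1
  ext y
  simp only [Finset.mem_image, Finset.mem_univ, true_and]
  have key : ∀ (a : ℤ) (x : ℤ), ∃ t : Fin k, (σ (a + t) : ZMod n) = σ x := by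
    intro a x
    have h1 := Int.emod_nonneg (x - a) hk'.ne'
    have h2 := Int.emod_lt_of_pos (x - a) hk'
    refine ⟨⟨((x - a) % k).toNat, by omega⟩, ?_⟩
    rw [cast_eq_iff]
    refine ⟨(x - a) / k, ?_⟩
    rw [← hσk]
    congr 1
    have := Int.emod_add_mul_ediv (x - a) k
    simp only; omega
  constructor
  · rintro ⟨t, rfl⟩
    rw [← hστ]
    exact key q t
  · rintro ⟨t, rfl⟩
    obtain ⟨t', h⟩ := key 0 (q + t)
    refine ⟨t', ?_⟩
    rw [← h, zero_add, hστ]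

theorem pluck_eq {R : Type*} [CommRing R] {k n : ℕ} (hn : 0 < n) (hk : 0 < k)
    (M : Matrix (Fin k) (ZMod n) R) (τ : Fin k → ℤ)
    (h : (∀ t t' z, τ t' = τ t + n * z → t = t') → StrictMono τ ∧ ∀ t t', τ t < τ t' + n) :
    pluck M (Finset.univ.image fun t => (τ t : ZMod n)) =
      Matrix.det (Matrix.of fun t : Fin k => twc M (τ t)) := by
  by_cases hi : ∀ t t' z, τ t' = τ t + n * z → t = t'
  · exact pluck_sm hn hk M τ (h hi).1 (h hi).2
  · push Not at hi
    obtain ⟨t, t', z, hz, hne⟩ := hi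
    have h1 : ¬ (Finset.univ.image fun t => (τ t : ZMod n)).card = k := by
      intro hc
      have hinj : Function.Injective (fun t => (τ t : ZMod n)) := by
        have := (Finset.card_image_iff (s := Finset.univ) (f := fun t => (τ t : ZMod n))).1
          (by rw [hc]; simp)
        simpa [Set.injOn_univ] using this
      exact hne (hinj ((cast_eq_iff _ _).2 ⟨z, hz⟩))
    unfold pluck
    rw [dif_neg (fun h => h1 h.2)]
    set A := (Matrix.of fun t : Fin k => twc M (τ t)) with hA
    have : A = A.updateRow t' ((((((-1 : ℤˣ) ^ (k - 1)) ^ z : ℤˣ) : ℤ) : R) • A t) := by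
      ext x c
      by_cases hx : x = t'
      · subst hx
        rw [Matrix.updateRow_self]
        simp only [hA, Matrix.of_apply, hz, twc_add hn, Pi.smul_apply]
      · rw [Matrix.updateRow_ne hx]
    rw [this, Matrix.det_updateRow_smul, Matrix.det_updateRow_eq_zero hne, mul_zero]

theorem val_sub_rep {n : ℕ} (hn : 0 < n) (x y : ZMod n) (X Y : ℤ) (hX : (X : ZMod n) = x)
    (hY : (Y : ZMod n) = y) (h1 : - (n : ℤ) ≤ X - Y) (h2 : X - Y < n) :
    (0 ≤ X - Y ∧ ((x - y).val : ℤ) = X - Y) ∨ (X - Y < 0 ∧ ((x - y).val : ℤ) = X - Y + n) := by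
  have : NeZero n := ⟨by omega⟩
  have e : x - y = ((X - Y : ℤ) : ZMod n) := by push_cast; rw [hX, hY]
  rw [e, ZMod.val_intCast]
  by_cases h : 0 ≤ X - Y
  · left; exact ⟨h, Int.emod_eq_of_lt h h2⟩
  · right
    refine ⟨by omega, ?_⟩
    rw [← Int.add_emod_right]
    exact Int.emod_eq_of_lt (by omega) (by omega)

theorem mem_cIco_of {n : ℕ} (hn : 0 < n) (a b x : ZMod n) (h : (x - a).val < (b - a).val) :
    x ∈ cIco n a b := by
  have : NeZero n := ⟨by omega⟩
  unfold cIco cIcc cSeg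
  rw [Finset.mem_erase]
  refine ⟨fun e => by subst e; omega, ?_⟩
  rw [Finset.mem_image]
  exact ⟨(x - a).val, by simp; omega, by simp⟩

theorem lift_exists {n s : ℕ} (hn : 0 < n) (hs : 1 ≤ s) (c0 : ZMod n) (m : Fin s → ZMod n)
    (hc1 : ∃ b : Fin s, StrictMono (fun t : Fin s => rep n (m (b + t))))
    (hc2 : c0 ∉ cIco n (m ⟨0, by omega⟩) (m ⟨s - 1, by omega⟩)) :
    ∃ μ : Fin s → ℤ, StrictMono μ ∧ ∀ j, (μ j : ZMod n) = m j ∧ (c0.val : ℤ) < μ j ∧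
      μ j ≤ c0.val + n := by
  have : NeZero n := ⟨by omega⟩
  obtain ⟨b, hb⟩ := hc1
  have hv := ZMod.val_lt c0
  set c := c0.val with hc
  have ec : ((c : ℤ) : ZMod n) = c0 := by simp [hc]
  have hr := fun j => rep_bounds hn (m j)
  have er : ∀ j, (((rep n (m j) : ℕ) : ℤ) : ZMod n) = m j := by
    intro j; rw [Int.cast_natCast]; exact (hr j).2.2
  have hcmp : ∀ i j : Fin s, i < j →
      (¬ (i < b ∧ b ≤ j) ∧ rep n (m i) < rep n (m j)) ∨
      ((i < b ∧ b ≤ j) ∧ rep n (m j) < rep n (m i)) := by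
    have hsub : ∀ i : Fin s, ∃ t : Fin s, b + t = i ∧
        (t : ℕ) = if b ≤ i then (i : ℕ) - b else s + i - b := by
      intro i
      refine ⟨⟨if b ≤ i then (i : ℕ) - b else s + i - b, ?_⟩, ?_, rfl⟩
      · split_ifs with h <;> [skip; rw [Fin.le_def] at h] <;> omega
      · ext
        simp only [Fin.val_add]
        split_ifs with h
        · rw [Fin.le_def] at h
          rw [show (b : ℕ) + (i - b) = i by omega, Nat.mod_eq_of_lt i.2]
        · rw [Fin.le_def] at h
          rw [show (b : ℕ) + (s + i - b) = i + s by omega, Nat.add_mod_right,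
            Nat.mod_eq_of_lt i.2]
    intro i j hij
    obtain ⟨ti, hi, hi'⟩ := hsub i
    obtain ⟨tj, hj, hj'⟩ := hsub j
    rw [Fin.lt_def] at hij
    by_cases h : i < b ∧ b ≤ j
    · right
      refine ⟨h, ?_⟩
      have : tj < ti := by
        rw [Fin.lt_def, hi', hj', if_pos h.2, if_neg (not_le.2 h.1)]
        have := h.1; rw [Fin.lt_def] at this; omega
      have := hb this
      simp only [hi, hj] at this; exact this
    · left
      refine ⟨h, ?_⟩
      have : ti < tj := by
        rw [Fin.lt_def, hi', hj']
        simp only [Fin.lt_def, Fin.le_def] at *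
        split_ifs <;> omega
      have := hb this
      simp only [hi, hj] at this; exact this
  have hc2' : ¬ (c0 - m ⟨0, by omega⟩).val < (m ⟨s - 1, by omega⟩ - m ⟨0, by omega⟩).val :=
    fun h => hc2 (mem_cIco_of hn _ _ _ h)
  set z0 : Fin s := ⟨0, by omega⟩
  set zl : Fin s := ⟨s - 1, by omega⟩
  have d1 := val_sub_rep hn c0 (m z0) c (rep n (m z0)) ec (er _)
    (by have := hr z0; omega) (by have := hr z0; omega)
  have d2 := val_sub_rep hn (m zl) (m z0) (rep n (m zl)) (rep n (m z0)) (er _) (er _)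
    (by have := hr z0; have := hr zl; omega) (by have := hr z0; have := hr zl; omega)
  refine ⟨fun j => if c < rep n (m j) then rep n (m j) else rep n (m j) + n, ?_, ?_⟩
  · intro i j hij
    have hcc := hcmp i j hij
    have h0i : z0 = i ∨ z0 < i := by
      rcases eq_or_lt_of_le (show z0 ≤ i from by simp [Fin.le_def, z0]) with h | h <;> simp [h]
    have hjl : j = zl ∨ j < zl := by
      rcases eq_or_lt_of_le (show j ≤ zl from by simp only [Fin.le_def, zl]; omega) with h | h <;>
        simp [h]
    have a1 : z0 = i ∨ (¬ (z0 < b ∧ b ≤ i) ∧ rep n (m z0) < rep n (m i)) ∨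
      ((z0 < b ∧ b ≤ i) ∧ rep n (m i) < rep n (m z0)) := h0i.imp id (hcmp _ _)
    have a2 : j = zl ∨ (¬ (j < b ∧ b ≤ zl) ∧ rep n (m j) < rep n (m zl)) ∨
      ((j < b ∧ b ≤ zl) ∧ rep n (m zl) < rep n (m j)) := hjl.imp id (hcmp _ _)
    have a3 := hcmp z0 zl (lt_of_le_of_lt (by simp [Fin.le_def, z0]) (lt_of_lt_of_le hij
      (by simp only [Fin.le_def, zl]; omega)))
    have b1 := hr i
    have b2 := hr j
    have b3 := hr z0
    have b4 := hr zl
    have a1' : rep n (m z0) = rep n (m i) ∧ (z0 : ℕ) = i ∨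
      (¬ (z0 < b ∧ b ≤ i) ∧ rep n (m z0) < rep n (m i)) ∨
      ((z0 < b ∧ b ≤ i) ∧ rep n (m i) < rep n (m z0)) :=
        a1.imp (fun h => by rw [h]; simp) id
    have a2' : rep n (m j) = rep n (m zl) ∧ (j : ℕ) = zl ∨
      (¬ (j < b ∧ b ≤ zl) ∧ rep n (m j) < rep n (m zl)) ∨
      ((j < b ∧ b ≤ zl) ∧ rep n (m zl) < rep n (m j)) :=
        a2.imp (fun h => by rw [h]; simp) id
    have v0 : (z0 : ℕ) = 0 := rfl
    have vl : (zl : ℕ) = s - 1 := rfl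
    have i1 := i.2
    have i2 := j.2
    have i3 := b.2
    clear a1 a2 h0i hjl hb hcmp hr er
    simp only [Fin.lt_def, Fin.le_def, v0, vl] at *
    split_ifs <;> omega
  · intro j
    have := hr j
    dsimp only
    split_ifs with h
    · exact ⟨er j, by omega, by omega⟩
    · refine ⟨?_, by omega, by omega⟩
      rw [Int.cast_add, er]; simp

theorem statement3 {R : Type*} [CommRing R] (k n : ℕ) (hk : 2 ≤ k) (hkn : 2 * k ≤ n)
    (M : Matrix (Fin k) (ZMod n) R) (r : ZMod n) (s : ℕ) (hs : 1 ≤ s) (hsk : s ≤ k)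
    (m : Fin s → ZMod n)
    (hc1 : ∃ b : Fin s, StrictMono (fun t : Fin s => rep n (m (b + t))))
    (hc2 : (r + (k : ZMod n) - 2) ∉ cIco n (m ⟨0, by omega⟩) (m ⟨s - 1, by omega⟩)) :
    Matrix.det (Matrix.of fun i j : Fin s =>
        pluck M (cSeg n (r + ((i : ℕ) : ZMod n)) (k - 1) ∪ {m j})) =
      (∏ l ∈ Finset.range (s - 1), pluck M (cSeg n (r + (l : ZMod n)) k)) *
        pluck M (cSeg n (r + (s : ZMod n) - 1) (k - s) ∪ Finset.image m Finset.univ) := by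
  have hn : 0 < n := by omega
  have : NeZero n := ⟨by omega⟩
  have hk0 : 0 < k := by omega
  obtain ⟨μ, hμm, hμ⟩ := lift_exists hn hs _ m hc1 hc2
  obtain ⟨ρ, hρ, hρc⟩ : ∃ ρ : ℤ, (ρ : ZMod n) = r ∧
      (((r + (k : ZMod n) - 2).val : ℕ) : ℤ) = ρ + k - 2 := by
    refine ⟨(r + (k : ZMod n) - 2).val - k + 2, ?_, by ring⟩
    push_cast
    rw [ZMod.natCast_zmod_val]; ring
  rw [hρc] at hμ
  clear hρc hc1 hc2
  obtain ⟨p, rfl⟩ : ∃ p, k = p + s := ⟨k - s, by omega⟩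
  let w : ℕ → Fin (p + s) → R := fun i => twc M (ρ + i)
  let u : Fin s → Fin (p + s) → R := fun j => twc M (μ j)
  have main := alg_main hs w u
  have E1 : ∀ i j : Fin s, pluck M (cSeg n (r + ((i : ℕ) : ZMod n)) (p + s - 1) ∪ {m j}) =
      ((winM w i).updateRow ⟨p + s - 1, by omega⟩ (u j)).det := by
    intro i j
    obtain ⟨hj1, hj2, hj3⟩ := hμ j
    have := pluck_eq hn hk0 M
      (fun t => if (t : ℕ) < p + s - 1 then ρ + (i : ℕ) + (t : ℕ) else μ j) (by
      intro hinj
      have h1 : ρ + (i : ℕ) + (p + s) - 2 < μ j := by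
        by_contra hcon
        have := hinj ⟨(μ j - ρ - i).toNat, by omega⟩ ⟨p + s - 1, by omega⟩ 0 (by
          simp only
          rw [if_neg (by omega), if_pos (by omega)]; omega)
        rw [Fin.mk.injEq] at this; omega
      have h2 : μ j < ρ + (i : ℕ) + n := by
        by_contra hcon
        have := hinj ⟨(μ j - ρ - i - n).toNat, by omega⟩ ⟨p + s - 1, by omega⟩ 1 (by
          simp only
          rw [if_neg (by omega), if_pos (by omega)]; omega)
        rw [Fin.mk.injEq] at this; omega
      constructor
      · intro a b hab
        rw [Fin.lt_def] at hab
        dsimp only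
        split_ifs <;> omega
      · intro a b
        split_ifs <;> omega)
    convert this using 2
    · ext y
      simp only [cSeg, Finset.mem_union, Finset.mem_image, Finset.mem_range, Finset.mem_singleton,
        Finset.mem_univ, true_and]
      constructor
      · rintro (⟨t, ht, rfl⟩ | rfl)
        · exact ⟨⟨t, by omega⟩, by simp [ht, hρ]⟩
        · exact ⟨⟨p + s - 1, by omega⟩, by simp [hj1]⟩
      · rintro ⟨t, rfl⟩
        split_ifs with h
        · left; exact ⟨t, h, by simp [hρ]⟩
        · right; exact hj1
    · ext t c
      by_cases ht : t = ⟨p + s - 1, by omega⟩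
      · subst ht
        rw [Matrix.updateRow_self]; simp [u]
      · rw [Matrix.updateRow_ne ht]
        have : (t : ℕ) < p + s - 1 := by
          simp only [Fin.ext_iff] at ht; omega
        simp [winM, w, this, add_assoc]
  have E2 : ∀ l : ℕ, pluck M (cSeg n (r + (l : ZMod n)) (p + s)) = (winM w l).det := by
    intro l
    have := pluck_eq hn hk0 M (fun t => ρ + l + (t : ℕ)) (by
      intro _
      constructor
      · intro a b hab
        rw [Fin.lt_def] at hab
        dsimp only
        omega
      · intro a b
        omega)
    convert this using 2
    · ext y
      simp only [cSeg, Finset.mem_image, Finset.mem_range, Finset.mem_univ, true_and]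
      constructor
      · rintro ⟨t, ht, rfl⟩
        exact ⟨⟨t, by omega⟩, by simp [hρ]⟩
      · rintro ⟨t, rfl⟩
        exact ⟨t, t.2, by simp [hρ]⟩
    · ext t c
      simp [winM, w, add_assoc]
  have E3 : pluck M (cSeg n (r + (s : ZMod n) - 1) (p + s - s) ∪ Finset.image m Finset.univ) =
      (appM w u).det := by
    have hsp : ∀ i j, μ i < μ j + n := fun i j => by
      have := hμ i; have := hμ j; omega
    have := pluck_eq hn hk0 M
      (fun t => Fin.addCases (fun a : Fin p => ρ + (s - 1) + ((a : ℕ) : ℤ)) (fun j => μ j) t) (by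
      intro hinj
      have h2 : ∀ j (a : Fin p), μ j < ρ + (s - 1) + (a : ℕ) + n := by
        intro j a
        by_contra hcon
        have := hμ j
        have := hinj (Fin.castAdd s ⟨(μ j - ρ - (s - 1) - n).toNat, by omega⟩) (Fin.natAdd p j) 1 (by
          simp only [Fin.addCases_left, Fin.addCases_right]
          omega)
        rw [Fin.ext_iff] at this
        simp only [Fin.val_castAdd, Fin.val_natAdd] at this
        omega
      constructor
      · intro a b hab
        induction a using Fin.addCases with
        | left a => 
          induction b using Fin.addCases with
          | left b =>
            rw [Fin.lt_def] at hab
            simp only [Fin.addCases_left, Fin.val_castAdd] at *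
            omega
          | right b => 
            simp only [Fin.addCases_left, Fin.addCases_right]
            have := hμ b
            omega
        | right a => 
          induction b using Fin.addCases with
          | left b =>
            rw [Fin.lt_def] at hab
            simp only [Fin.val_castAdd, Fin.val_natAdd] at hab
            omega
          | right b => 
            simp only [Fin.addCases_right]
            apply hμm
            rw [Fin.lt_def] at *
            simpa using hab
      · intro a b
        induction a using Fin.addCases with
        | left a => 
          induction b using Fin.addCases with
          | left b =>
            simp only [Fin.addCases_left]
            omega
          | right b => 
            simp only [Fin.addCases_left, Fin.addCases_right]
            have := hμ b
            omega
        | right a => 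
          induction b using Fin.addCases with
          | left b =>
            simp only [Fin.addCases_left, Fin.addCases_right]
            exact h2 a b
          | right b => 
            simp only [Fin.addCases_right]
            exact hsp a b)
    convert this using 2
    · ext y
      simp only [cSeg, Finset.mem_union, Finset.mem_image, Finset.mem_range,
        Finset.mem_univ, true_and]
      constructor
      · rintro (⟨t, ht, rfl⟩ | ⟨j, rfl⟩)
        · refine ⟨Fin.castAdd s ⟨t, by omega⟩, ?_⟩
          simp only [Fin.addCases_left]
          push_cast; rw [hρ]; ring
        · refine ⟨Fin.natAdd p j, ?_⟩
          simp only [Fin.addCases_right]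
          exact (hμ j).1
      · rintro ⟨t, rfl⟩
        induction t using Fin.addCases with
        | left a =>
          left
          refine ⟨a, by omega, ?_⟩
          simp only [Fin.addCases_left]
          push_cast; rw [hρ]; ring
        | right j =>
          right
          refine ⟨j, ?_⟩
          simp only [Fin.addCases_right]
          exact (hμ j).1.symm
    · ext t c
      induction t using Fin.addCases with
      | left a =>
        simp only [appM, Matrix.of_apply, Fin.addCases_left, w]
        congr 1
        push_cast [Nat.cast_sub hs]; ring
      | right j =>
        simp only [appM, Matrix.of_apply, Fin.addCases_right, u]
  simp only [E1, E2, E3]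
  exact main
end

section
/- Let k, n be integers with 1 < k < n−1 and n ≥ k+2. Let r, m ∈ ℤ/nℤ with m in the cyclic closed interval [r+k, r−2], so that I := [r]^{k−1} ∪ {m} is a non-consecutive almost consecutive k-subset of ℤ/nℤ, and let s, p ∈ ℤ/nℤ with p ∉ [s]^{k−1}, and set J := [s]^{k−1} ∪ {p}. Then I and J are crossing if and only if either (s lies in the cyclic closed interval [r+1, m−k+1] and p lies in the cyclic closed interval [m+1, r−1]) or (s lies in the cyclic closed interval [m+1, r−1] and p lies in the cyclic closed interval [r+k−1, m−1]). -/
/-- The cyclic open interval `(a,b) = [a,b] ∖ {a,b}` in `ZMod n`. -/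
def cOo (n : ℕ) (a b : ZMod n) : Finset (ZMod n) := ((cIcc n a b).erase a).erase b

/-- Two subsets `I, J` of `ZMod n` are crossing if there are `a, c ∈ I ∖ J` and
`b, d ∈ J ∖ I` with `b ∈ (a,c)` and `d ∈ (c,a)`. -/
def Crossing (n : ℕ) (I J : Finset (ZMod n)) : Prop :=
  ∃ a ∈ I \ J, ∃ c ∈ I \ J, ∃ b ∈ J \ I, ∃ d ∈ J \ I, b ∈ cOo n a c ∧ d ∈ cOo n c a

/-- A subset of `ZMod n` is a consecutive `k`-subset if it is `[r]^k` for some `r`. -/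
def Consec (n k : ℕ) (I : Finset (ZMod n)) : Prop := ∃ r : ZMod n, I = cSeg n r k

/-- A subset of `ZMod n` is an almost consecutive `k`-subset if it is
`[r]^(k-1) ∪ {m}` for some `r` and some `m ∉ [r]^(k-1)`. -/
def AlmostConsec (n k : ℕ) (I : Finset (ZMod n)) : Prop :=
  ∃ r m : ZMod n, m ∉ cSeg n r (k - 1) ∧ I = cSeg n r (k - 1) ∪ {m}

theorem mem_cSeg_iff {n : ℕ} [NeZero n] (r x : ZMod n) (l : ℕ) (hl : l ≤ n) :
    x ∈ cSeg n r l ↔ (x - r).val < l := by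
  unfold cSeg
  simp only [Finset.mem_image, Finset.mem_range]
  constructor
  · rintro ⟨t, ht, rfl⟩
    rw [add_sub_cancel_left, ZMod.val_natCast_of_lt (by omega)]
    exact ht
  · intro h
    exact ⟨(x - r).val, h, by rw [ZMod.natCast_zmod_val]; ring⟩

theorem mem_cIcc_iff {n : ℕ} [NeZero n] (a b x : ZMod n) :
    x ∈ cIcc n a b ↔ (x - a).val ≤ (b - a).val := by
  unfold cIcc
  rw [mem_cSeg_iff _ _ _ (ZMod.val_lt (b - a)), Nat.lt_succ_iff]

theorem val_sub_base {n : ℕ} [NeZero n] (r x y : ZMod n) :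
    (x - y).val = if (y - r).val ≤ (x - r).val then (x - r).val - (y - r).val
      else (x - r).val + n - (y - r).val := by
  have hxy : x - y = (x - r) - (y - r) := by ring
  rw [hxy]
  generalize x - r = u
  generalize y - r = v
  have hv := ZMod.val_lt v
  split_ifs with h
  · exact ZMod.val_sub h
  · have : u - v = ((u.val + n - v.val : ℕ) : ZMod n) := by
      rw [Nat.cast_sub (by omega)]
      simp
    rw [this, ZMod.val_natCast_of_lt (by omega)]

theorem eq_iff_base {n : ℕ} [NeZero n] (r x y : ZMod n) :
    x = y ↔ (x - r).val = (y - r).val := by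
  constructor
  · rintro rfl; rfl
  · intro h
    simpa using ZMod.val_injective n h

theorem base_val {n : ℕ} (r x : ZMod n) (t : ℕ) (ht : t < n)
    (h : x = r + (t : ZMod n)) : (x - r).val = t := by
  rw [h, add_sub_cancel_left, ZMod.val_natCast_of_lt ht]

theorem mem_cSeg_base {n : ℕ} [NeZero n] (r s x : ZMod n) (l : ℕ) (hl : l ≤ n) :
    x ∈ cSeg n s l ↔
      ((s - r).val ≤ (x - r).val ∧ (x - r).val < (s - r).val + l) ∨
      (x - r).val + n < (s - r).val + l := by
  rw [mem_cSeg_iff _ _ _ hl, val_sub_base r x s]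
  have h1 := ZMod.val_lt (x - r)
  have h2 := ZMod.val_lt (s - r)
  split_ifs <;> omega

theorem mem_cIcc_base {n : ℕ} [NeZero n] (r a b x : ZMod n) (h : (a - r).val ≤ (b - r).val) :
    x ∈ cIcc n a b ↔ (a - r).val ≤ (x - r).val ∧ (x - r).val ≤ (b - r).val := by
  rw [mem_cIcc_iff, val_sub_base r x a, val_sub_base r b a]
  have h1 := ZMod.val_lt (x - r)
  have h2 := ZMod.val_lt (b - r)
  split_ifs <;> omega

theorem mem_cOo_base {n : ℕ} [NeZero n] (r a b x : ZMod n) :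
    x ∈ cOo n a b ↔ ((a - r).val < (x - r).val ∧ (x - r).val < (b - r).val) ∨
      ((x - r).val < (b - r).val ∧ (b - r).val < (a - r).val) ∨
      ((b - r).val < (a - r).val ∧ (a - r).val < (x - r).val) := by
  unfold cOo
  rw [Finset.mem_erase, Finset.mem_erase, mem_cIcc_iff, val_sub_base r x a, val_sub_base r b a,
    Ne, Ne, eq_iff_base r x a, eq_iff_base r x b]
  have h1 := ZMod.val_lt (x - r)
  have h2 := ZMod.val_lt (b - r)
  have h3 := ZMod.val_lt (a - r)
  split_ifs <;> omega

/-- The arithmetic core of the forward direction, with the choice `c = m`. -/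
theorem core_forward (n k M S P a b d : ℕ) (hM : k ≤ M) (hMn : M + 2 ≤ n)
    (hS : S < n) (hP : P < n) (hd : d < n) (hk : 1 < k)
    (haI : a < k - 1)
    (haJ : ¬ ((S ≤ a ∧ a < S + (k - 1)) ∨ a + n < S + (k - 1)))
    (hMJ : ¬ ((S ≤ M ∧ M < S + (k - 1)) ∨ M + n < S + (k - 1)))
    (hbJ : ((S ≤ b ∧ b < S + (k - 1)) ∨ b + n < S + (k - 1)) ∨ b = P)
    (hdJ : ((S ≤ d ∧ d < S + (k - 1)) ∨ d + n < S + (k - 1)) ∨ d = P)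
    (hb : k - 1 ≤ b) (hbM : b < M) (hdM : M < d) :
    ((1 ≤ S ∧ S ≤ M - k + 1) ∧ (M + 1 ≤ P ∧ P ≤ n - 1)) ∨
    ((M + 1 ≤ S ∧ S ≤ n - 1) ∧ (k - 1 ≤ P ∧ P ≤ M - 1)) := by
  omega

theorem statement4 (k n : ℕ) (hk : 1 < k) (hkn : k < n - 1) (hn : k + 2 ≤ n)
    (r m : ZMod n) (hm : m ∈ cIcc n (r + (k : ZMod n)) (r - 2))
    (s p : ZMod n) (hp : p ∉ cSeg n s (k - 1)) :
    Crossing n (cSeg n r (k - 1) ∪ {m}) (cSeg n s (k - 1) ∪ {p}) ↔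
      ((s ∈ cIcc n (r + 1) (m - (k : ZMod n) + 1) ∧ p ∈ cIcc n (m + 1) (r - 1)) ∨
       (s ∈ cIcc n (m + 1) (r - 1) ∧ p ∈ cIcc n (r + (k : ZMod n) - 1) (m - 1))) := by
  have : NeZero n := ⟨by omega⟩
  have hl : k - 1 ≤ n := by omega
  have e0 : (r - r).val = 0 := by simp
  have ek : (r + (k : ZMod n) - r).val = k := base_val r _ k (by omega) rfl
  have e2 : (r - 2 - r).val = n - 2 := base_val r _ _ (by omega) (by
    rw [Nat.cast_sub (by omega)]; simp; ring)
  have e1 : (r - 1 - r).val = n - 1 := base_val r _ _ (by omega) (by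
    rw [Nat.cast_sub (by omega)]; simp; ring)
  have e1' : (r + 1 - r).val = 1 := base_val r _ _ (by omega) (by simp)
  have ek1 : (r + (k : ZMod n) - 1 - r).val = k - 1 := base_val r _ _ (by omega) (by
    rw [Nat.cast_sub (by omega)]; simp; ring)
  rw [mem_cIcc_base r _ _ _ (by omega), ek, e2] at hm
  obtain ⟨hm1, hm2⟩ := hm
  have em : m = r + (((m - r).val : ℕ) : ZMod n) := by
    rw [ZMod.natCast_zmod_val]; ring
  have emk : (m - (k : ZMod n) + 1 - r).val = (m - r).val - k + 1 := base_val r _ _ (by omega) (by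
    rw [Nat.cast_add, Nat.cast_sub (by omega), ZMod.natCast_zmod_val]; simp; ring)
  have em1 : (m + 1 - r).val = (m - r).val + 1 := base_val r _ _ (by omega) (by
    rw [Nat.cast_add, ZMod.natCast_zmod_val]; simp; ring)
  have em1' : (m - 1 - r).val = (m - r).val - 1 := base_val r _ _ (by omega) (by
    rw [Nat.cast_sub (by omega), ZMod.natCast_zmod_val]; simp; ring)
  rw [mem_cIcc_base r _ _ _ (by omega), mem_cIcc_base r _ _ _ (by omega),
    mem_cIcc_base r _ _ _ (by omega), mem_cIcc_base r _ _ _ (by omega),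
    e1, e1', ek1, emk, em1, em1']
  rw [mem_cSeg_base r _ _ _ hl] at hp
  have hS := ZMod.val_lt (s - r)
  have hP := ZMod.val_lt (p - r)
  unfold Crossing
  simp only [Finset.mem_sdiff, Finset.mem_union, Finset.mem_singleton, mem_cSeg_base r _ _ _ hl,
    mem_cOo_base r, eq_iff_base r, e0]
  constructor
  · rintro ⟨a, ⟨haI, haJ⟩, c, ⟨hcI, hcJ⟩, b, ⟨hbJ, hbI⟩, d, ⟨hdJ, hdI⟩, hb, hd⟩
    have ha' := ZMod.val_lt (a - r)
    have hb' := ZMod.val_lt (b - r)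
    have hc' := ZMod.val_lt (c - r)
    have hd' := ZMod.val_lt (d - r)
    rw [not_or] at haJ hcJ
    generalize (a - r).val = A at *
    generalize (b - r).val = B at *
    generalize (c - r).val = C at *
    generalize (d - r).val = D at *
    have hcase : (A < k - 1 ∧ C = (m - r).val) ∨ (C < k - 1 ∧ A = (m - r).val) := by
      clear haJ hcJ hbJ hdJ hp
      omega
    rcases hcase with ⟨hA, hC⟩ | ⟨hC, hA⟩
    · subst hC
      refine core_forward n k _ _ _ A B D hm1 (by omega) hS hP hd' hk hA haJ.1 hcJ.1 hbJ hdJ ?_ ?_ ?_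
      all_goals clear haJ hcJ hbJ hdJ hp; omega
    · subst hA
      refine core_forward n k _ _ _ C D B hm1 (by omega) hS hP hb' hk hC hcJ.1 haJ.1 hdJ hbJ ?_ ?_ ?_
      all_goals clear haJ hcJ hbJ hdJ hp; omega
  · rintro (⟨⟨h1, h2⟩, h3, h4⟩ | ⟨⟨h1, h2⟩, h3, h4⟩)
    · have eb : (r + (((s - r).val + k - 2 : ℕ) : ZMod n) - r).val = (s - r).val + k - 2 :=
        base_val r _ _ (by omega) rfl
      refine ⟨r, ?_, m, ?_, r + (((s - r).val + k - 2 : ℕ) : ZMod n), ?_, p, ?_, ?_, ?_⟩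
      all_goals try simp only [eb, e0, or_true, true_and]
      all_goals omega
    · have eb : (r + ((k - 2 : ℕ) : ZMod n) - r).val = k - 2 :=
        base_val r _ _ (by omega) rfl
      refine ⟨r + ((k - 2 : ℕ) : ZMod n), ?_, m, ?_, p, ?_, s, ?_, ?_, ?_⟩
      all_goals try simp only [eb, or_true, true_and]
      all_goals omega
end

section
/- Let k, n be integers with 2 ≤ k ≤ n−2, and assume moreover that 2k ≤ n or k = 4. Then there exists a collection of (k−1)(n−k−1) pairwise distinct, pairwise non-crossing k-subsets of ℤ/nℤ, each of which is almost consecutive but not consecutive, if and only if k = 2, or k = 3, or (k,n) = (4,6). -/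
def off (n a b : ℕ) : ℕ := if a ≤ b then b - a else b + n - a

def Cr (n k : ℕ) (x y : ℕ × ℕ) : Prop :=
  0 < off n x.1 y.1 ∧ off n x.1 y.1 + k ≤ off n x.1 x.2 + 1 ∧ off n x.1 x.2 < off n x.1 y.2

instance (n k : ℕ) (x y : ℕ × ℕ) : Decidable (Cr n k x y) := by unfold Cr; infer_instance

def Val (n k : ℕ) (x : ℕ × ℕ) : Prop :=
  x.1 < n ∧ x.2 < n ∧ k ≤ off n x.1 x.2 ∧ off n x.1 x.2 + 2 ≤ n

instance (n k : ℕ) (x : ℕ × ℕ) : Decidable (Val n k x) := by unfold Val; infer_instance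

def phi (n : ℕ) (x : ℕ × ℕ) : ℕ × ℕ :=
  (if x.1 = n then n - 1 else x.1, if x.2 = n then 0 else x.2)

/-- merging keeps non-crossing -/
lemma cr_of_phi (n k : ℕ) (hk : 4 ≤ k) (hn : k + 2 ≤ n) (x y : ℕ × ℕ)
    (hx : Val (n+1) k x) (hy : Val (n+1) k y)
    (hx' : Val n k (phi n x)) (hy' : Val n k (phi n y))
    (h : Cr n k (phi n x) (phi n y)) : Cr (n+1) k x y := by
  obtain ⟨r, m⟩ := x
  obtain ⟨s, l⟩ := y
  simp only [Cr, Val, phi, off] at *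
  by_cases h1 : r = n <;> by_cases h2 : m = n <;> by_cases h3 : s = n <;> by_cases h4 : l = n <;>
    simp only [h1, h2, h3, h4, if_true, if_false] at * <;> grind

def lab (n k : ℕ) (x : ℕ × ℕ) : ℕ :=
  if x.2 = n then 0 else if x.1 = n ∨ x.1 = 0 then 1
  else if x.1 + k = n + 1 then 0 else if n ≤ x.1 + 2 then 2 else n - x.1

def Bad (n k : ℕ) (T : Finset (ℕ × ℕ)) (x : ℕ × ℕ) : Prop :=
  ¬ Val n k (phi n x) ∨ (x.1 = n ∧ (n - 1, x.2) ∈ T) ∨ (x.2 = n ∧ (x.1, 0) ∈ T)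

lemma not_val_cases (n k : ℕ) (hk : 4 ≤ k) (hn : k + 2 ≤ n) (x : ℕ × ℕ)
    (hx : Val (n+1) k x) (h : ¬ Val n k (phi n x)) :
    (x.1 = 1 ∧ x.2 = n) ∨ (x.1 = 0 ∧ x.2 + 1 = n) ∨ (x.1 = n ∧ x.2 + 2 = n) ∨
    (x.1 < n ∧ x.1 + k = x.2 + (n + 1)) := by
  obtain ⟨r, m⟩ := x
  simp only [Val, phi, off] at *
  obtain ⟨h1, h2, h3, h4⟩ := hx
  by_contra hcon
  apply h
  split_ifs at * <;> omega

lemma key_inj (n k : ℕ) (hk : 4 ≤ k) (hn : k + 2 ≤ n) (T : Finset (ℕ × ℕ))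
    (hT : ∀ x ∈ T, Val (n+1) k x) (hC : ∀ x ∈ T, ∀ y ∈ T, ¬ Cr (n+1) k x y)
    (x y : ℕ × ℕ) (hx : x ∈ T) (hy : y ∈ T)
    (hxb : ¬ Bad n k T x) (hyb : ¬ Bad n k T y) (h : phi n x = phi n y) : x = y := by
  have vx := hT x hx
  have vy := hT y hy
  obtain ⟨r, m⟩ := x
  obtain ⟨s, l⟩ := y
  simp only [Bad, not_or, not_and, not_not] at hxb hyb
  obtain ⟨-, hx1, hx2⟩ := hxb
  obtain ⟨-, hy1, hy2⟩ := hyb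
  simp only [phi, Prod.mk.injEq] at h ⊢
  have key : ∀ a b c d : ℕ, Val (n+1) k (a,b) → Val (n+1) k (c,d) → a = n → b ≠ n → c + 1 = n → d = n → b = 0 → False := by
    intro a b c d h1 h2
    simp only [Val, off] at h1 h2
    grind
  have key2 : ∀ a b : ℕ, Val (n+1) k (a,b) → a = n → b = n → False := by
    intro a b h1
    simp only [Val, off] at h1
    grind
  have key3 : ∀ b : ℕ, Val (n+1) k (n,b) → b = 0 → False := by
    intro b h1
    simp only [Val, off] at h1
    grind
  have key4 : ∀ b : ℕ, Val (n+1) k (n-1,b) → b = n → False := by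
    intro b h1
    simp only [Val, off] at h1
    grind
  by_cases h1 : r = n <;> by_cases h2 : m = n <;> by_cases h3 : s = n <;> by_cases h4 : l = n <;>
    simp only [h1, h2, h3, h4, if_true, if_false] at * <;> grind

lemma lab_lt (n k : ℕ) (hk : 4 ≤ k) (hn : k + 2 ≤ n) (T : Finset (ℕ × ℕ))
    (x : ℕ × ℕ) (vx : Val (n+1) k x) (hb : Bad n k T x) : lab n k x < k - 1 := by
  have hc : ((x.1 = 1 ∧ x.2 = n) ∨ (x.1 = 0 ∧ x.2 + 1 = n) ∨ (x.1 = n ∧ x.2 + 2 = n) ∨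
    (x.1 < n ∧ x.1 + k = x.2 + (n + 1))) ∨ x.1 = n ∨ x.2 = n := by
    rcases hb with h | h | h
    · exact Or.inl (not_val_cases n k hk hn x vx h)
    · exact Or.inr (Or.inl h.1)
    · exact Or.inr (Or.inr h.1)
  simp only [lab, Val, off] at *
  split_ifs at * <;> omega

lemma fact_b (n k : ℕ) (hk : 4 ≤ k) (hn : k + 2 ≤ n) (m l : ℕ)
    (h1 : Val (n+1) k (n-1, m)) (h2 : Val (n+1) k (n, l)) (h : ¬ Cr (n+1) k (n-1,m) (n,l)) :
    l ≤ m ∧ m + 3 ≤ n := by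
  simp only [Cr, Val, off] at *
  split_ifs at * <;> omega

lemma fact_L (n k : ℕ) (hk : 4 ≤ k) (hn : k + 2 ≤ n) (m : ℕ)
    (h2 : Val (n+1) k (n, m)) (h : ¬ Cr (n+1) k (n,m) (0,n-1)) : False := by
  simp only [Cr, Val, off] at *
  split_ifs at * <;> omega

lemma fact_a (n k : ℕ) (hk : 4 ≤ k) (hn : k + 2 ≤ n) (r s : ℕ) (hr : 0 < r) (hrs : r < s) (hs : s + k ≤ n + 1)
    (h : ¬ Cr (n+1) k (r,n) (s,0)) : False := by
  simp only [Cr, off] at *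
  split_ifs at * <;> omega

lemma fact_R (n k : ℕ) (hk : 4 ≤ k) (hn : k + 2 ≤ n) (i j : ℕ) (hi : i + 1 < n) (hj : i + k = j + (n+1))
    (h : ¬ Cr (n+1) k (i,j) (i+1,j+1)) : False := by
  simp only [Cr, off] at *
  split_ifs at * <;> omega

lemma fact_v (n k : ℕ) (r : ℕ) (h : Val (n+1) k (r,n)) : r + k ≤ n := by
  simp only [Val, off] at *
  split_ifs at * <;> omega

lemma bad_cases (n k : ℕ) (hk : 4 ≤ k) (hn : k + 2 ≤ n) (T : Finset (ℕ × ℕ))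
    (r m : ℕ) (vx : Val (n+1) k (r,m)) (hb : Bad n k T (r,m)) :
    (m = n ∧ r + k ≤ n ∧ (r = 1 ∨ (r,0) ∈ T)) ∨
    (m ≠ n ∧ r = 0 ∧ m = n - 1) ∨
    (m ≠ n ∧ r = n ∧ (m + 2 = n ∨ (n-1,m) ∈ T)) ∨
    (m ≠ n ∧ 0 < r ∧ r < n ∧ r + k = m + (n + 1)) := by
  have hv := fact_v n k r
  rcases hb with h | h | h
  · have := not_val_cases n k hk hn (r,m) vx h
    grind
  · have : m ≠ n := by
      rintro rfl
      have := hv vx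
      simp only at h
      omega
    grind
  · grind

lemma lab_inj (n k : ℕ) (hk : 4 ≤ k) (hn : k + 2 ≤ n) (T : Finset (ℕ × ℕ))
    (hT : ∀ x ∈ T, Val (n+1) k x) (hC : ∀ x ∈ T, ∀ y ∈ T, ¬ Cr (n+1) k x y)
    (x y : ℕ × ℕ) (hx : x ∈ T) (hy : y ∈ T)
    (hxb : Bad n k T x) (hyb : Bad n k T y) (h : lab n k x = lab n k y) : x = y := by
  obtain ⟨r, m⟩ := x
  obtain ⟨s, l⟩ := y
  have Fb : ∀ m l, (n-1,m) ∈ T → (n,l) ∈ T → l ≤ m ∧ m + 3 ≤ n := fun m l h1 h2 =>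
    fact_b n k hk hn m l (hT _ h1) (hT _ h2) (hC _ h1 _ h2)
  have FL : ∀ m, (n,m) ∈ T → (0,n-1) ∈ T → False := fun m h1 h2 =>
    fact_L n k hk hn m (hT _ h1) (hC _ h1 _ h2)
  have Fa : ∀ r s, (r,n) ∈ T → (s,0) ∈ T → 0 < r → r < s → s + k ≤ n + 1 → False := fun r s h1 h2 h0 h3 h4 =>
    fact_a n k hk hn r s h0 h3 h4 (hC _ h1 _ h2)
  have FR : ∀ i j, (i,j) ∈ T → (i+1,j+1) ∈ T → i + 1 < n → i + k = j + (n+1) → False :=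
    fun i j h1 h2 h3 h4 => fact_R n k hk hn i j h3 h4 (hC _ h1 _ h2)
  have cx := bad_cases n k hk hn T r m (hT _ hx) hxb
  have cy := bad_cases n k hk hn T s l (hT _ hy) hyb
  have vr0 : ∀ r, (r,0) ∈ T → r ≠ 0 := by
    rintro r hr rfl
    have := hT _ hr
    simp only [Val, off] at this
    simp at this
    omega
  simp only [lab] at h
  clear hxb hyb hT hC
  rcases cx with ⟨h1, h2, h3⟩ | ⟨h1, h2, h3⟩ | ⟨h1, h2, h3⟩ | ⟨h1, h2, h3, h4⟩ <;>
  rcases cy with ⟨g1, g2, g3⟩ | ⟨g1, g2, g3⟩ | ⟨g1, g2, g3⟩ | ⟨g1, g2, g3, g4⟩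
  · grind
  · grind
  · grind
  · subst h1
    have : l = 0 := by split_ifs at h <;> omega
    subst this
    exact (Fa r s hx hy (by grind) (by omega) (by omega)).elim
  · grind
  · grind
  · grind
  · grind
  · grind
  · grind
  · grind
  · grind
  · subst g1
    have : m = 0 := by split_ifs at h <;> omega
    subst this
    exact (Fa s r hy hx (by grind) (by omega) (by omega)).elim
  · grind
  · grind
  · have : r = s ∨ s = r + 1 ∨ r = s + 1 := by split_ifs at h <;> omega
    rcases this with e | e | e
    · grind
    · subst e
      have : l = m + 1 := by omega
      subst this
      exact (FR r m hx hy (by omega) (by omega)).elim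
    · subst e
      have : m = l + 1 := by omega
      subst this
      exact (FR s l hy hx (by omega) (by omega)).elim

open Classical in
lemma step (n k : ℕ) (hk : 4 ≤ k) (hn : k + 2 ≤ n) (T : Finset (ℕ × ℕ))
    (hT : ∀ x ∈ T, Val (n+1) k x) (hC : ∀ x ∈ T, ∀ y ∈ T, ¬ Cr (n+1) k x y) :
    ∃ T' : Finset (ℕ × ℕ), (∀ x ∈ T', Val n k x) ∧ (∀ x ∈ T', ∀ y ∈ T', ¬ Cr n k x y) ∧
      T.card ≤ T'.card + (k - 1) := by
  have hgood : ∀ x ∈ T, ¬ Bad n k T x → Val n k (phi n x) := by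
    intro x _ hb
    by_contra hv
    exact hb (Or.inl hv)
  refine ⟨(T.filter (fun x => ¬ Bad n k T x)).image (phi n), ?_, ?_, ?_⟩
  · intro x hx
    simp only [Finset.mem_image, Finset.mem_filter] at hx
    obtain ⟨y, ⟨hy, hb⟩, rfl⟩ := hx
    exact hgood y hy hb
  · intro x hx y hy hcr
    simp only [Finset.mem_image, Finset.mem_filter] at hx hy
    obtain ⟨x, ⟨hx, hbx⟩, rfl⟩ := hx
    obtain ⟨y, ⟨hy, hby⟩, rfl⟩ := hy
    exact hC x hx y hy (cr_of_phi n k hk hn x y (hT _ hx) (hT _ hy) (hgood _ hx hbx)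
      (hgood _ hy hby) hcr)
  · rw [Finset.card_image_of_injOn, ← Finset.card_filter_add_card_filter_not (s := T) (fun x => ¬ Bad n k T x)]
    · have : (T.filter (fun x => ¬ ¬ Bad n k T x)).card ≤ (Finset.range (k-1)).card := by
        apply Finset.card_le_card_of_injOn (lab n k)
        · intro x hx
          simp only [not_not, Finset.coe_filter, Set.mem_ofPred_eq] at hx
          simp only [Finset.coe_range, Set.mem_Iio]
          exact lab_lt n k hk hn T x (hT _ hx.1) hx.2
        · intro x hx y hy h
          simp only [not_not, Finset.coe_filter, Set.mem_ofPred_eq] at hx hy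
          exact lab_inj n k hk hn T hT hC x y hx.1 hy.1 hx.2 hy.2 h
      rw [Finset.card_range] at this
      omega
    · intro x hx y hy h
      simp only [Finset.coe_filter, Set.mem_ofPred_eq] at hx hy
      exact key_inj n k hk hn T hT hC x y hx.1 hy.1 hx.2 hy.2 h

lemma base_big (k : ℕ) (hk : 5 ≤ k) (T : Finset (ℕ × ℕ))
    (hT : ∀ x ∈ T, Val (k+2) k x) (hC : ∀ x ∈ T, ∀ y ∈ T, ¬ Cr (k+2) k x y) :
    T.card < k - 1 := by
  let f : ℕ × ℕ → ℕ := fun x => x.1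
  let g : ℕ × ℕ → ℕ := fun x => if x.1 = k + 1 then 0 else x.1 + 1
  have hd : Disjoint (T.image f) (T.image g) := by
    rw [Finset.disjoint_left]
    intro a ha hb
    simp only [Finset.mem_image] at ha hb
    obtain ⟨x, hx, rfl⟩ := ha
    obtain ⟨y, hy, hxy⟩ := hb
    have h1 := hT _ hx
    have h2 := hT _ hy
    have h3 := hC _ hy _ hx
    simp only [f, g] at hxy
    simp only [Val, Cr, off] at h1 h2 h3
    split_ifs at * <;> omega
  have hs : T.image f ∪ T.image g ⊆ Finset.range (k+2) := by
    intro a ha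
    simp only [Finset.mem_union, Finset.mem_image] at ha
    rw [Finset.mem_range]
    rcases ha with ⟨x, hx, rfl⟩ | ⟨x, hx, rfl⟩
    · exact (hT _ hx).1
    · have := (hT _ hx).1
      simp only [g]
      split_ifs <;> omega
  have h1 := Finset.card_le_card hs
  rw [Finset.card_union_of_disjoint hd, Finset.card_image_of_injOn, Finset.card_image_of_injOn,
    Finset.card_range] at h1
  · omega
  · intro x hx y hy h
    have h1 := hT _ hx
    have h2 := hT _ hy
    simp only [g] at h
    simp only [Val, off] at h1 h2
    ext <;> split_ifs at * <;> omega
  · intro x hx y hy h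
    have h1 := hT _ hx
    have h2 := hT _ hy
    simp only [f] at h
    simp only [Val, off] at h1 h2
    ext <;> split_ifs at * <;> omega

def V7 : Finset (ℕ × ℕ) := (Finset.range 7 ×ˢ Finset.range 7).filter (Val 7 4)

lemma V7_dec : ∀ T ∈ V7.powersetCard 6, ∃ x ∈ T, ∃ y ∈ T, Cr 7 4 x y := by
  decide +kernel

lemma base_four (T : Finset (ℕ × ℕ))
    (hT : ∀ x ∈ T, Val 7 4 x) (hC : ∀ x ∈ T, ∀ y ∈ T, ¬ Cr 7 4 x y) :
    T.card < 6 := by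
  by_contra h
  push Not at h
  obtain ⟨U, hU, hc⟩ := Finset.exists_subset_card_eq h
  obtain ⟨x, hx, y, hy, hxy⟩ := V7_dec U (by
    rw [Finset.mem_powersetCard]
    refine ⟨?_, hc⟩
    intro x hx
    have := hT x (hU hx)
    simp only [V7, Finset.mem_filter, Finset.mem_product, Finset.mem_range]
    exact ⟨⟨this.1, this.2.1⟩, this⟩)
  exact hC x (hU hx) y (hU hy) hxy

lemma main_bound (k n : ℕ) (hk : 4 ≤ k) (hn : k + 2 ≤ n) (h : k = 4 → 7 ≤ n) (T : Finset (ℕ × ℕ))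
    (hT : ∀ x ∈ T, Val n k x) (hC : ∀ x ∈ T, ∀ y ∈ T, ¬ Cr n k x y) :
    T.card < (k - 1) * (n - k - 1) := by
  induction n generalizing T with
  | zero => omega
  | succ n ih =>
    by_cases hb : k + 2 = n + 1
    · have hk5 : 5 ≤ k := by
        by_contra h5
        have := h (by omega)
        omega
      rw [← hb] at hT hC
      have := base_big k hk5 T hT hC
      have e : n + 1 - k - 1 = 1 := by omega
      rw [e]
      omega
    · by_cases h4 : k = 4 ∧ n = 6
      · obtain ⟨rfl, rfl⟩ := h4
        exact base_four T hT hC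
      · obtain ⟨T', h1, h2, h3⟩ := step n k hk (by omega) T hT hC
        have := ih (by omega) (by intro e; have := h e; omega) T' h1 h2
        have e : n + 1 - k - 1 = (n - k - 1) + 1 := by omega
        rw [e, Nat.mul_add]
        omega

lemma off_val (n : ℕ) [NeZero n] (a b : ZMod n) : (b - a).val = off n a.val b.val := by
  unfold off
  have ha := ZMod.val_lt a
  have hb := ZMod.val_lt b
  split_ifs with h
  · exact ZMod.val_sub h
  · have h' : b.val ≤ a.val := by omega
    have h1 : (a - b).val = a.val - b.val := ZMod.val_sub h'
    have h2 : b - a = -(a - b) := by ring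
    rw [h2, ZMod.neg_val, h1, if_neg]
    · omega
    · intro h0
      rw [h0, ZMod.val_zero] at h1
      omega

lemma mem_cSeg (n : ℕ) [NeZero n] (r x : ZMod n) (l : ℕ) (hl : l ≤ n) :
    x ∈ cSeg n r l ↔ off n r.val x.val < l := by
  rw [← off_val]
  unfold cSeg
  simp only [Finset.mem_image, Finset.mem_range]
  constructor
  · rintro ⟨t, ht, rfl⟩
    rw [add_sub_cancel_left, ZMod.val_natCast_of_lt (by omega)]
    exact ht
  · intro h
    refine ⟨_, h, ?_⟩
    rw [ZMod.natCast_zmod_val]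
    ring

lemma card_cSeg (n : ℕ) [NeZero n] (r : ZMod n) (l : ℕ) (hl : l ≤ n) : (cSeg n r l).card = l := by
  unfold cSeg
  rw [Finset.card_image_of_injOn, Finset.card_range]
  intro a ha b hb h
  simp only [Finset.coe_range, Set.mem_Iio] at ha hb
  have h' := congrArg ZMod.val (add_left_cancel h)
  rwa [ZMod.val_natCast_of_lt (by omega), ZMod.val_natCast_of_lt (by omega)] at h'

lemma mem_cOo (n : ℕ) [NeZero n] (a b x : ZMod n) :
    x ∈ cOo n a b ↔ 0 < off n a.val x.val ∧ off n a.val x.val < off n a.val b.val := by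
  unfold cOo cIcc
  have hlt := ZMod.val_lt (b - a)
  simp only [Finset.mem_erase]
  rw [mem_cSeg n _ _ _ (by omega), off_val]
  have h1 : x = a ↔ x.val = a.val := (ZMod.val_injective n).eq_iff.symm
  have h2 : x = b ↔ x.val = b.val := (ZMod.val_injective n).eq_iff.symm
  rw [Ne, Ne, h1, h2]
  have ha := ZMod.val_lt a
  have hb := ZMod.val_lt b
  have hx := ZMod.val_lt x
  unfold off
  split_ifs <;> omega

lemma mem_set (n k : ℕ) [NeZero n] (hk : k ≤ n) (r m x : ZMod n) :
    x ∈ cSeg n r (k-1) ∪ {m} ↔ off n r.val x.val < k - 1 ∨ x.val = m.val := by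
  rw [Finset.mem_union, mem_cSeg n _ _ _ (by omega), Finset.mem_singleton,
    (ZMod.val_injective n).eq_iff]

lemma crossing_of_Cr (n k : ℕ) [NeZero n] (hk : 2 ≤ k) (hkn : k ≤ n) (r m r' m' : ZMod n)
    (hv : Val n k (r.val, m.val)) (hv' : Val n k (r'.val, m'.val))
    (h : Cr n k (r.val, m.val) (r'.val, m'.val)) :
    Crossing n (cSeg n r (k-1) ∪ {m}) (cSeg n r' (k-1) ∪ {m'}) := by
  obtain ⟨e, he⟩ : ∃ e : ZMod n, off n r'.val e.val = k - 2 := by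
    refine ⟨r' + ((k - 2 : ℕ) : ZMod n), ?_⟩
    rw [← off_val, add_sub_cancel_left, ZMod.val_natCast_of_lt (by omega)]
  have hlt := ZMod.val_lt e
  refine ⟨r, ?_, m, ?_, e, ?_, m', ?_, ?_, ?_⟩
  all_goals
    simp only [Finset.mem_sdiff, mem_set n k hkn, mem_cOo]
    simp only [Cr, Val] at *
    generalize r.val = r at *
    generalize m.val = m at *
    generalize r'.val = r' at *
    generalize m'.val = m' at *
    generalize e.val = e at *
    try simp only [or_true, true_and]
    unfold off at *
    split_ifs at * <;> omega

lemma upper (n k : ℕ) (hk : 4 ≤ k) (hn : k + 2 ≤ n) (h : k = 4 → 7 ≤ n)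
    (S : Finset (Finset (ZMod n)))
    (h1 : ∀ I ∈ S, I.card = k ∧ AlmostConsec n k I ∧ ¬ Consec n k I)
    (h2 : ∀ I ∈ S, ∀ J ∈ S, ¬ Crossing n I J) : S.card < (k - 1) * (n - k - 1) := by
  haveI : NeZero n := ⟨by omega⟩
  have hex : ∀ I : Finset (ZMod n), ∃ p : ZMod n × ZMod n, I ∈ S →
      I = cSeg n p.1 (k-1) ∪ {p.2} ∧ Val n k (p.1.val, p.2.val) := by
    intro I
    by_cases hI : I ∈ S
    · obtain ⟨-, ⟨r, m, hm, rfl⟩, hc⟩ := h1 I hI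
      refine ⟨(r, m), fun _ => ⟨rfl, ?_⟩⟩
      rw [mem_cSeg n _ _ _ (by omega)] at hm
      have hr := ZMod.val_lt r
      have hml := ZMod.val_lt m
      have c1 : off n r.val m.val ≠ k - 1 := by
        intro he
        apply hc
        refine ⟨r, ?_⟩
        ext x
        rw [mem_set n k (by omega), mem_cSeg n _ _ _ (by omega)]
        have hx := ZMod.val_lt x
        unfold off at *
        split_ifs at * <;> omega
      have c2 : off n r.val m.val ≠ n - 1 := by
        intro he
        apply hc
        refine ⟨m, ?_⟩
        ext x
        rw [mem_set n k (by omega), mem_cSeg n _ _ _ (by omega)]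
        have hx := ZMod.val_lt x
        unfold off at *
        split_ifs at * <;> omega
      simp only [Val]
      unfold off at *
      split_ifs at * <;> omega
    · exact ⟨(0, 0), fun h => (hI h).elim⟩
  choose f hf using hex
  let g : Finset (ZMod n) → ℕ × ℕ := fun I => ((f I).1.val, (f I).2.val)
  have hg : Set.InjOn g S := by
    intro I hI J hJ h
    simp only [g, Prod.mk.injEq] at h
    have e1 := ZMod.val_injective n h.1
    have e2 := ZMod.val_injective n h.2
    rw [(hf I hI).1, (hf J hJ).1, e1, e2]
  rw [← Finset.card_image_of_injOn hg]
  apply main_bound k n hk hn h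
  · intro x hx
    rw [Finset.mem_image] at hx
    obtain ⟨I, hI, rfl⟩ := hx
    exact (hf I hI).2
  · intro x hx y hy hcr
    rw [Finset.mem_image] at hx hy
    obtain ⟨I, hI, rfl⟩ := hx
    obtain ⟨J, hJ, rfl⟩ := hy
    apply h2 I hI J hJ
    have := crossing_of_Cr n k (by omega) (by omega) _ _ _ _ (hf I hI).2 (hf J hJ).2 hcr
    rwa [← (hf I hI).1, ← (hf J hJ).1] at this

/-- The set attached to a pair of natural numbers. -/
def PS (n k : ℕ) (p : ℕ × ℕ) : Finset (ZMod n) := cSeg n (p.1 : ZMod n) (k-1) ∪ {(p.2 : ZMod n)}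

lemma mem_PS (n k : ℕ) [NeZero n] (hk : k ≤ n) (p : ℕ × ℕ) (hp : Val n k p) (x : ZMod n) :
    x ∈ PS n k p ↔ off n p.1 x.val < k - 1 ∨ x.val = p.2 := by
  unfold PS
  rw [mem_set n k hk, ZMod.val_natCast_of_lt hp.1, ZMod.val_natCast_of_lt hp.2.1]

lemma PS_ok (n k : ℕ) [NeZero n] (hk : 2 ≤ k) (hkn : 2 * k ≤ n) (p : ℕ × ℕ) (hp : Val n k p) :
    (PS n k p).card = k ∧ AlmostConsec n k (PS n k p) ∧ ¬ Consec n k (PS n k p) := by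
  have hnot : (p.2 : ZMod n) ∉ cSeg n (p.1 : ZMod n) (k-1) := by
    rw [mem_cSeg n _ _ _ (by omega), ZMod.val_natCast_of_lt hp.1, ZMod.val_natCast_of_lt hp.2.1]
    have := hp.2.2.1
    omega
  refine ⟨?_, ⟨_, _, hnot, rfl⟩, ?_⟩
  · unfold PS
    rw [Finset.card_union_of_disjoint (by rwa [Finset.disjoint_singleton_right]),
      card_cSeg n _ _ (by omega), Finset.card_singleton]
    omega
  · rintro ⟨ρ, hρ⟩
    have hmem : ∀ x : ZMod n, off n p.1 x.val < k - 1 ∨ x.val = p.2 ↔ off n ρ.val x.val < k := by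
      intro x
      rw [← mem_PS n k (by omega) p hp, hρ, mem_cSeg n _ _ _ (by omega)]
    have hmem' : ∀ x : ℕ, x < n → (off n p.1 x < k - 1 ∨ x = p.2 ↔ off n ρ.val x < k) := by
      intro x hx
      have := hmem (x : ZMod n)
      rwa [ZMod.val_natCast_of_lt hx] at this
    obtain ⟨r, m⟩ := p
    obtain ⟨q1, q2, q3, q4⟩ := hp
    simp only at *
    have hρ' := ZMod.val_lt ρ
    generalize ρ.val = t at *
    obtain ⟨e, he, heo⟩ : ∃ e, e < n ∧ off n r e = k - 2 := by
      refine ⟨if r + (k-2) < n then r + (k-2) else r + (k-2) - n, ?_, ?_⟩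
      · split_ifs <;> omega
      · unfold off
        split_ifs <;> omega
    have a1 := (hmem' r q1).1 (Or.inl (by unfold off; simp; omega))
    have a2 := (hmem' e he).1 (Or.inl (by omega))
    have a3 := (hmem' m q2).1 (Or.inr rfl)
    clear hmem hmem' hnot
    unfold off at *
    split_ifs at * <;> omega

lemma lower_of (n k : ℕ) [NeZero n] (hk : 2 ≤ k) (hkn : 2 * k ≤ n) (P : Finset (ℕ × ℕ))
    (hP : ∀ p ∈ P, Val n k p) (hinj : Set.InjOn (PS n k) P)
    (hc : ∀ p ∈ P, ∀ q ∈ P, ¬ Crossing n (PS n k p) (PS n k q)) :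
    ∃ S : Finset (Finset (ZMod n)),
        S.card = P.card ∧
        (∀ I ∈ S, I.card = k ∧ AlmostConsec n k I ∧ ¬ Consec n k I) ∧
        (∀ I ∈ S, ∀ J ∈ S, ¬ Crossing n I J) := by
  refine ⟨P.image (PS n k), Finset.card_image_of_injOn hinj, ?_, ?_⟩
  · intro I hI
    rw [Finset.mem_image] at hI
    obtain ⟨p, hp, rfl⟩ := hI
    exact PS_ok n k hk hkn p (hP p hp)
  · intro I hI J hJ
    rw [Finset.mem_image] at hI hJ
    obtain ⟨p, hp, rfl⟩ := hI
    obtain ⟨q, hq, rfl⟩ := hJ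
    exact hc p hp q hq

lemma PS_inj (n k : ℕ) [NeZero n] (hk : k ≤ n) (p q : ℕ × ℕ) (hp : Val n k p) (hq : Val n k q)
    (h : PS n k p = PS n k q) (x : ℕ) (hx : x < n) :
    off n p.1 x < k - 1 ∨ x = p.2 ↔ off n q.1 x < k - 1 ∨ x = q.2 := by
  have h1 := mem_PS n k hk p hp (x : ZMod n)
  have h2 := mem_PS n k hk q hq (x : ZMod n)
  rw [ZMod.val_natCast_of_lt hx] at h1 h2
  rw [← h1, ← h2, h]

lemma PS_cross (n k : ℕ) [NeZero n] (hk : k ≤ n) (p q : ℕ × ℕ) (hp : Val n k p) (hq : Val n k q)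
    (h : Crossing n (PS n k p) (PS n k q)) : ∃ a < n, ∃ b < n, ∃ c < n, ∃ d < n,
      (off n p.1 a < k - 1 ∨ a = p.2) ∧ (off n p.1 c < k - 1 ∨ c = p.2) ∧
      ¬ (off n q.1 a < k - 1 ∨ a = q.2) ∧ ¬ (off n q.1 c < k - 1 ∨ c = q.2) ∧
      (off n q.1 b < k - 1 ∨ b = q.2) ∧ (off n q.1 d < k - 1 ∨ d = q.2) ∧
      ¬ (off n p.1 b < k - 1 ∨ b = p.2) ∧ ¬ (off n p.1 d < k - 1 ∨ d = p.2) ∧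
      0 < off n a b ∧ off n a b < off n a c ∧ 0 < off n c d ∧ off n c d < off n c a := by
  obtain ⟨a, ha, c, hc, b, hb, d, hd, h1, h2⟩ := h
  rw [Finset.mem_sdiff, mem_PS n k hk p hp, mem_PS n k hk q hq] at ha hc
  rw [Finset.mem_sdiff, mem_PS n k hk p hp, mem_PS n k hk q hq] at hb hd
  rw [mem_cOo] at h1 h2
  exact ⟨a.val, ZMod.val_lt a, b.val, ZMod.val_lt b, c.val, ZMod.val_lt c, d.val, ZMod.val_lt d,
    ha.1, hc.1, ha.2, hc.2, hb.1, hd.1, hb.2, hd.2, h1.1, h1.2, h2.1, h2.2⟩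

lemma lower_two (n : ℕ) (hn : 4 ≤ n) : ∃ S : Finset (Finset (ZMod n)),
        S.card = (2 - 1) * (n - 2 - 1) ∧
        (∀ I ∈ S, I.card = 2 ∧ AlmostConsec n 2 I ∧ ¬ Consec n 2 I) ∧
        (∀ I ∈ S, ∀ J ∈ S, ¬ Crossing n I J) := by
  haveI : NeZero n := ⟨by omega⟩
  let P : Finset (ℕ × ℕ) := (Finset.Icc 2 (n-2)).image (fun m => (0, m))
  have hcard : P.card = (2 - 1) * (n - 2 - 1) := by
    rw [Finset.card_image_of_injective _ (fun a b h => by simpa using h), Nat.card_Icc]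
    omega
  have hmem : ∀ p ∈ P, p.1 = 0 ∧ 2 ≤ p.2 ∧ p.2 + 2 ≤ n := by
    intro p hp
    simp only [P, Finset.mem_image, Finset.mem_Icc] at hp
    obtain ⟨m, hm, rfl⟩ := hp
    simp only [true_and]
    omega
  have hval : ∀ p ∈ P, Val n 2 p := by
    intro p hp
    obtain ⟨h1, h2, h3⟩ := hmem p hp
    simp only [Val, off, h1]
    split_ifs <;> omega
  rw [← hcard]
  apply lower_of n 2 (by omega) (by omega) P hval
  · intro p hp q hq h
    have h1 := (PS_inj n 2 (by omega) p q (hval p hp) (hval q hq) h p.2 (hval p hp).2.1).1 (Or.inr rfl)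
    obtain ⟨p1, p2, p3⟩ := hmem p hp
    obtain ⟨q1, q2, q3⟩ := hmem q hq
    have e : ∀ x, off n 0 x = x := by intro x; simp [off]
    rw [q1, e] at h1
    ext <;> omega
  · intro p hp q hq h
    obtain ⟨a, ha, b, hb, c, hc, d, hd, h⟩ :=
      PS_cross n 2 (by omega) p q (hval p hp) (hval q hq) h
    obtain ⟨p1, p2, p3⟩ := hmem p hp
    obtain ⟨q1, q2, q3⟩ := hmem q hq
    rw [p1, q1] at h
    obtain ⟨h1, h2, h3, h4, h5, h6, h7, h8, h9, h10, h11, h12⟩ := h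
    have e : ∀ x, off n 0 x = x := by intro x; simp [off]
    simp only [e] at h1 h2 h3 h4 h5 h6 h7 h8
    have : a = c := by omega
    subst this
    have e0 : off n a a = 0 := by simp [off]
    omega

lemma cross_nat (n a b c d : ℕ) (ha : a < n) (hb : b < n) (hc : c < n) (hd : d < n)
    (h9 : 0 < off n a b) (h10 : off n a b < off n a c) (h11 : 0 < off n c d)
    (h12 : off n c d < off n c a) : a ≠ c ∧ b ≠ d ∧
    ((a < b ∧ b < c ∧ (c < d ∨ d < a)) ∨ (c < d ∧ d < a ∧ (a < b ∨ b < c))) := by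
  unfold off at *
  split_ifs at * <;> omega

set_option maxHeartbeats 1000000 in
lemma lower_three (n : ℕ) (hn : 6 ≤ n) : ∃ S : Finset (Finset (ZMod n)),
        S.card = (3 - 1) * (n - 3 - 1) ∧
        (∀ I ∈ S, I.card = 3 ∧ AlmostConsec n 3 I ∧ ¬ Consec n 3 I) ∧
        (∀ I ∈ S, ∀ J ∈ S, ¬ Crossing n I J) := by
  haveI : NeZero n := ⟨by omega⟩
  let P1 : Finset (ℕ × ℕ) := (Finset.Icc 3 (n-2)).image (fun m => (0, m))
  let P2 : Finset (ℕ × ℕ) := (Finset.Icc 2 (n-3)).image (fun m => (m, 0))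
  let P := P1 ∪ P2
  have hmem1 : ∀ p ∈ P1, p.1 = 0 ∧ 3 ≤ p.2 ∧ p.2 + 2 ≤ n := by
    intro p hp
    simp only [P1, Finset.mem_image, Finset.mem_Icc] at hp
    obtain ⟨m, hm, rfl⟩ := hp
    simp only [true_and]
    omega
  have hmem2 : ∀ p ∈ P2, p.2 = 0 ∧ 2 ≤ p.1 ∧ p.1 + 3 ≤ n := by
    intro p hp
    simp only [P2, Finset.mem_image, Finset.mem_Icc] at hp
    obtain ⟨m, hm, rfl⟩ := hp
    simp only [true_and]
    omega
  have hmem : ∀ p ∈ P, (p.1 = 0 ∧ 3 ≤ p.2 ∧ p.2 + 2 ≤ n) ∨ (p.2 = 0 ∧ 2 ≤ p.1 ∧ p.1 + 3 ≤ n) := by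
    intro p hp
    rcases Finset.mem_union.1 hp with h | h
    · exact Or.inl (hmem1 p h)
    · exact Or.inr (hmem2 p h)
  have hcard : P.card = (3 - 1) * (n - 3 - 1) := by
    rw [Finset.card_union_of_disjoint, Finset.card_image_of_injective _ (fun a b h => by simpa using h),
      Finset.card_image_of_injective _ (fun a b h => by simpa using h), Nat.card_Icc, Nat.card_Icc]
    · omega
    · rw [Finset.disjoint_left]
      intro p h1 h2
      have := hmem1 p h1
      have := hmem2 p h2
      omega
  have hval : ∀ p ∈ P, Val n 3 p := by
    intro p hp
    have := hmem p hp
    simp only [Val, off]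
    split_ifs <;> omega
  have desc : ∀ p ∈ P, ∀ x < n, (off n p.1 x < 3 - 1 ∨ x = p.2) ↔
      (x = 0 ∨ x = max p.1 1 ∨ x = max (p.1 + 1) p.2) := by
    intro p hp x hx
    have := hmem p hp
    unfold off
    split_ifs <;> omega
  rw [← hcard]
  apply lower_of n 3 (by omega) (by omega) P hval
  · intro p hp q hq h
    have hh := fun x hx => PS_inj n 3 (by omega) p q (hval p hp) (hval q hq) h x hx
    have h3 := hmem p hp
    have h4 := hmem q hq
    have h1 := hh (max p.1 1) (by omega)
    have h2 := hh (max (p.1 + 1) p.2) (by omega)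
    have h5 := hh (max q.1 1) (by omega)
    rw [desc p hp _ (by omega), desc q hq _ (by omega)] at h1 h2 h5
    ext <;> omega
  · intro p hp q hq h
    obtain ⟨a, ha, b, hb, c, hc, d, hd, h⟩ :=
      PS_cross n 3 (by omega) p q (hval p hp) (hval q hq) h
    rw [desc p hp _ ha, desc q hq _ ha, desc p hp _ hb, desc q hq _ hb, desc p hp _ hc,
      desc q hq _ hc, desc p hp _ hd, desc q hq _ hd] at h
    have h3 := hmem p hp
    have h4 := hmem q hq
    obtain ⟨h1, h2, k3, k4, h5, h6, h7, h8, h9, h10, h11, h12⟩ := h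
    obtain ⟨hac, hbd, C⟩ := cross_nat n a b c d ha hb hc hd h9 h10 h11 h12
    clear h9 h10 h11 h12
    have A : (a = max p.1 1 ∧ c = max (p.1 + 1) p.2) ∨ (c = max p.1 1 ∧ a = max (p.1 + 1) p.2) := by
      omega
    have B : (b = max q.1 1 ∧ d = max (q.1 + 1) q.2) ∨ (d = max q.1 1 ∧ b = max (q.1 + 1) q.2) := by
      omega
    clear h1 h2 k3 k4 h5 h6 h7 h8 hac hbd
    rcases h3 with ⟨p1, p2, p3⟩ | ⟨p1, p2, p3⟩ <;> rcases h4 with ⟨q1, q2, q3⟩ | ⟨q1, q2, q3⟩ <;>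
      rcases A with ⟨A1, A2⟩ | ⟨A1, A2⟩ <;> rcases B with ⟨B1, B2⟩ | ⟨B1, B2⟩ <;> omega

lemma lower_four : ∃ S : Finset (Finset (ZMod 6)),
        S.card = (4 - 1) * (6 - 4 - 1) ∧
        (∀ I ∈ S, I.card = 4 ∧ AlmostConsec 6 4 I ∧ ¬ Consec 6 4 I) ∧
        (∀ I ∈ S, ∀ J ∈ S, ¬ Crossing 6 I J) := by
  refine ⟨{{5, 0, 1, 3}, {3, 4, 5, 1}, {1, 2, 3, 5}}, ?_, ?_, ?_⟩
  · decide
  · unfold AlmostConsec Consec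
    decide +kernel
  · unfold Crossing
    decide +kernel

theorem statement5 (k n : ℕ) (hk : 2 ≤ k) (hkn : k ≤ n - 2) (h : 2 * k ≤ n ∨ k = 4) :
    (∃ S : Finset (Finset (ZMod n)),
        S.card = (k - 1) * (n - k - 1) ∧
        (∀ I ∈ S, I.card = k ∧ AlmostConsec n k I ∧ ¬ Consec n k I) ∧
        (∀ I ∈ S, ∀ J ∈ S, ¬ Crossing n I J)) ↔
      (k = 2 ∨ k = 3 ∨ (k = 4 ∧ n = 6)) := by
  constructor
  · rintro ⟨S, h0, h1, h2⟩
    by_contra hc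
    have := upper n k (by omega) (by omega) (by omega) S h1 h2
    omega
  · rintro (rfl | rfl | ⟨rfl, rfl⟩)
    · exact lower_two n (by omega)
    · exact lower_three n (by omega)
    · exact lower_four
end

section
/- Let n ∈ {6,7,8} and w = n−4. If F and F′ are tame integral SL₃-friezes of width w such that F(0,j) = F′(0,j) for all 0 ≤ j ≤ w−1 and F(i, w+1) = F′(i, w+1) for all 2 ≤ i ≤ w+1, then F = F′. In other words, a tame integral SL₃-frieze of width w is uniquely determined by these 2w entries. -/
/-- The domain of an SL₃-frieze of width `w`: pairs `(i,j)` with `-3 ≤ j - i ≤ w + 2`. -/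
def SL3Dom (w : ℕ) : Type :=
  {p : ℤ × ℤ // -3 ≤ p.2 - p.1 ∧ p.2 - p.1 ≤ (w : ℤ) + 2}

/-- Entry `F(i,j)` of a function on the strip, extended by the junk value `0` outside. -/
def extF (w : ℕ) (F : SL3Dom w → ℤ) (i j : ℤ) : ℤ :=
  if h : -3 ≤ j - i ∧ j - i ≤ (w : ℤ) + 2 then F ⟨(i, j), h⟩ else 0

/-- `F` is a tame integral SL₃-frieze of width `w`. -/
def IsSL3Frieze (w : ℕ) (F : SL3Dom w → ℤ) : Prop :=
  (∀ i j : ℤ, (j - i = -3 ∨ j - i = -2 ∨ j - i = (w : ℤ) + 1 ∨ j - i = (w : ℤ) + 2) →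
    extF w F i j = 0) ∧
  (∀ i j : ℤ, (j - i = -1 ∨ j - i = (w : ℤ)) → extF w F i j = 1) ∧
  (∀ i j : ℤ, 0 ≤ j - i → j - i ≤ (w : ℤ) - 1 → 1 ≤ extF w F i j) ∧
  (∀ i j : ℤ, -1 ≤ j - i → j - i ≤ (w : ℤ) →
    Matrix.det (Matrix.of fun a b : Fin 3 =>
      extF w F (i + ((a : ℕ) : ℤ)) (j + ((b : ℕ) : ℤ))) = 1) ∧
  (∀ i j : ℤ, 0 ≤ j - i → j - i ≤ (w : ℤ) - 1 →
    Matrix.det (Matrix.of fun a b : Fin 4 =>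
      extF w F (i + ((a : ℕ) : ℤ)) (j + ((b : ℕ) : ℤ))) = 0)

/-- 3 × 3 minor with rows `i, i+1, i+2` and arbitrary columns. -/
def minor3 (f : ℤ → ℤ → ℤ) (i x y z : ℤ) : ℤ :=
  f i x * (f (i+1) y * f (i+2) z - f (i+1) z * f (i+2) y)
  - f i y * (f (i+1) x * f (i+2) z - f (i+1) z * f (i+2) x)
  + f i z * (f (i+1) x * f (i+2) y - f (i+1) y * f (i+2) x)

/-- Explicit form of the frieze conditions. -/
structure Fz (w : ℤ) (f : ℤ → ℤ → ℤ) : Prop where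
  zero : ∀ i j : ℤ, (j - i = -3 ∨ j - i = -2 ∨ j - i = w + 1 ∨ j - i = w + 2) → f i j = 0
  one : ∀ i j : ℤ, (j - i = -1 ∨ j - i = w) → f i j = 1
  pos : ∀ i j : ℤ, 0 ≤ j - i → j - i ≤ w - 1 → 1 ≤ f i j
  d3 : ∀ i j : ℤ, -1 ≤ j - i → j - i ≤ w → minor3 f i j (j+1) (j+2) = 1
  d4 : ∀ i j : ℤ, 0 ≤ j - i → j - i ≤ w - 1 →
    f (i+3) (j+3) * minor3 f i j (j+1) (j+2) - f (i+3) (j+2) * minor3 f i j (j+1) (j+3)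
    + f (i+3) (j+1) * minor3 f i j (j+2) (j+3) - f (i+3) j * minor3 f i (j+1) (j+2) (j+3) = 0

theorem fz_of_frieze (w : ℕ) (F : SL3Dom w → ℤ) (h : IsSL3Frieze w F) : Fz w (extF w F) := by
  obtain ⟨h1, h2, h3, h4, h5⟩ := h
  refine ⟨h1, h2, h3, ?_, ?_⟩
  · intro i j ha hb
    have := h4 i j ha hb
    rw [Matrix.det_fin_three] at this
    simp at this
    unfold minor3
    linear_combination this
  · intro i j ha hb
    have := h5 i j ha hb
    rw [Matrix.det_succ_row_zero] at this
    simp [Fin.sum_univ_four, Matrix.det_fin_three, Fin.succAbove] at this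
    unfold minor3
    linear_combination this

theorem Fz.recur {w : ℤ} {f : ℤ → ℤ → ℤ} (h : Fz w f) (j : ℤ) (h0 : 0 ≤ j) (hj : j ≤ w - 1) :
    ∃ a b c : ℤ, ∀ k : ℕ, (k : ℤ) ≤ j + 3 →
      f k (j+3) = a * f k j + b * f k (j+1) + c * f k (j+2) := by
  have hd := h.d3 0 j (by omega) (by omega)
  refine ⟨minor3 f 0 (j+3) (j+1) (j+2), minor3 f 0 j (j+3) (j+2), minor3 f 0 j (j+1) (j+3), ?_⟩
  intro k
  induction k using Nat.strong_induction_on with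
  | _ k ih =>
  intro hk
  match k, ih, hk with
  | 0, ih, hk =>
    unfold minor3 at *
    simp only [zero_add, Nat.cast_zero] at *
    linear_combination (-f 0 (j+3)) * hd
  | 1, ih, hk =>
    unfold minor3 at *
    simp only [zero_add, Nat.cast_one] at *
    linear_combination (-f 1 (j+3)) * hd
  | 2, ih, hk =>
    unfold minor3 at *
    simp only [zero_add, Nat.cast_ofNat] at *
    linear_combination (-f 2 (j+3)) * hd
  | i+3, ih, hk =>
    push_cast at hk
    have e0 := ih i (by omega) (by omega)
    have e1 := ih (i+1) (by omega) (by push_cast; omega)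
    have e2 := ih (i+2) (by omega) (by push_cast; omega)
    have t4 := h.d4 i j (by omega) (by omega)
    have t3 := h.d3 i j (by omega) (by omega)
    clear ih
    push_cast at *
    generalize minor3 f 0 (j+3) (j+1) (j+2) = a at *
    generalize minor3 f 0 j (j+3) (j+2) = b at *
    generalize minor3 f 0 j (j+1) (j+3) = c at *
    have q1 : minor3 f i j (j+1) (j+3) = c := by
      unfold minor3 at t3 ⊢; rw [e0, e1, e2]; linear_combination c * t3
    have q2 : minor3 f i j (j+2) (j+3) = -b := by
      unfold minor3 at t3 ⊢; rw [e0, e1, e2]; linear_combination (-b) * t3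
    have q3 : minor3 f i (j+1) (j+2) (j+3) = a := by
      unfold minor3 at t3 ⊢; rw [e0, e1, e2]; linear_combination a * t3
    rw [t3, q1, q2, q3] at t4
    linear_combination t4

theorem Fz.row {w : ℤ} {f : ℤ → ℤ → ℤ} (h : Fz w f) (r : ℕ) (hr : 3 ≤ r) (hrw : (r : ℤ) ≤ w + 3)
    (m : ℕ) (hm : (r : ℤ) - 3 + m ≤ w + 2) :
    f r (r - 3 + m) = minor3 f 0 (r - 3) (r - 3 + 1) (r - 3 + m) := by
  induction m using Nat.strong_induction_on with
  | _ m ih =>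
  match m, ih, hm with
  | 0, ih, hm =>
    rw [h.zero _ _ (by left; push_cast; ring)]
    simp only [Nat.cast_zero, add_zero]
    unfold minor3; ring
  | 1, ih, hm =>
    rw [h.zero _ _ (by right; left; push_cast; ring)]
    simp only [Nat.cast_one]
    unfold minor3; ring
  | 2, ih, hm =>
    rw [h.one _ _ (by left; push_cast; ring)]
    simp only [Nat.cast_ofNat]
    rw [h.d3 _ _ (by omega) (by omega)]
  | m+3, ih, hm =>
    push_cast at hm
    obtain ⟨a, b, c, habc⟩ := h.recur (r - 3 + m) (by omega) (by omega)
    have i0 := ih m (by omega) (by omega)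
    have i1 := ih (m+1) (by omega) (by push_cast; omega)
    have i2 := ih (m+2) (by omega) (by push_cast; omega)
    have k0 := habc 0 (by push_cast; omega)
    have k1 := habc 1 (by push_cast; omega)
    have k2 := habc 2 (by push_cast; omega)
    have kr := habc r (by omega)
    clear ih
    push_cast at *
    simp only [← add_assoc] at *
    rw [kr, i0, i1, i2]
    unfold minor3
    simp only [zero_add] at *
    rw [k0, k1, k2]
    ring

/-- The column `w+1` in terms of rows 0, 1, 2. -/
theorem Fz.col {w : ℤ} {f : ℤ → ℤ → ℤ} (h : Fz w f) (hw : 1 ≤ w) (j : ℤ) (hj : -1 ≤ j)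
    (hjw : j ≤ w - 1) :
    f (j+3) (w+1) = minor3 f 0 j (j+1) (w+1) := by
  rcases eq_or_lt_of_le hj with rfl | hj
  · unfold minor3
    norm_num
    rw [h.one 0 (-1) (by norm_num), h.zero 0 (w+1) (by norm_num), h.zero 1 (-1) (by norm_num),
      h.zero 2 (-1) (by norm_num), h.one 1 0 (by norm_num), h.zero 2 0 (by norm_num)]
    ring
  · have := h.row (j+3).toNat (by omega) (by omega) (w+1-j).toNat (by omega)
    rw [Int.toNat_of_nonneg (by omega), Int.toNat_of_nonneg (by omega)] at this
    rwa [show j + 3 - 3 = j by ring, show j + (w+1-j) = w+1 by ring] at this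

/-- Two functions agree on row `i` of the strip. -/
def RowEq (w : ℤ) (f g : ℤ → ℤ → ℤ) (i : ℤ) : Prop :=
  ∀ j, -3 ≤ j - i → j - i ≤ w + 2 → f i j = g i j

theorem first_rows {w : ℤ} {f g : ℤ → ℤ → ℤ} (hf : Fz w f) (hg : Fz w g) (hw : 1 ≤ w)
    (h1 : ∀ j : ℤ, 0 ≤ j → j ≤ w - 1 → f 0 j = g 0 j)
    (h2 : ∀ i : ℤ, 2 ≤ i → i ≤ w + 1 → f i (w + 1) = g i (w + 1)) :
    RowEq w f g 0 ∧ RowEq w f g 1 ∧ RowEq w f g 2 := by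
  have R0 : RowEq w f g 0 := by
    intro j ha hb
    by_cases c1 : j = -3 ∨ j = -2 ∨ j = w + 1 ∨ j = w + 2
    · rw [hf.zero 0 j (by omega), hg.zero 0 j (by omega)]
    by_cases c2 : j = -1 ∨ j = w
    · rw [hf.one 0 j (by omega), hg.one 0 j (by omega)]
    exact h1 j (by omega) (by omega)
  have C : ∀ i : ℤ, 2 ≤ i → i ≤ w + 2 → f i (w+1) = g i (w+1) := by
    intro i ha hb
    by_cases c : i = w + 2
    · rw [hf.one i (w+1) (by omega), hg.one i (w+1) (by omega)]
    · exact h2 i ha (by omega)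
  have cc := C 2 le_rfl (by omega)
  have f0 : f 0 (w+1) = 0 := hf.zero _ _ (by omega)
  have g0 : g 0 (w+1) = 0 := hg.zero _ _ (by omega)
  have f1 : f 1 (w+1) = 1 := hf.one _ _ (by omega)
  have g1 : g 1 (w+1) = 1 := hg.one _ _ (by omega)
  have Z : ∀ {u : ℤ → ℤ → ℤ}, Fz w u → ∀ j, -1 ≤ j → j ≤ w → u 0 j ≠ 0 := by
    intro u hu j ha hb
    by_cases c2 : j = -1 ∨ j = w
    · rw [hu.one 0 j (by omega)]; norm_num
    · have := hu.pos 0 j (by omega) (by omega)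
      omega
  -- the second coordinate in the quotient by column `w+1`
  have E : ∀ m : ℕ, (m : ℤ) ≤ w + 1 →
      f 2 (m - 1) - f 2 (w+1) * f 1 (m - 1) = g 2 (m - 1) - f 2 (w+1) * g 1 (m - 1) := by
    intro m
    induction m with
    | zero =>
      intro _
      simp only [Nat.cast_zero, zero_sub]
      rw [hf.zero 2 (-1) (by norm_num), hg.zero 2 (-1) (by norm_num),
        hf.zero 1 (-1) (by norm_num), hg.zero 1 (-1) (by norm_num)]
    | succ m ih =>
      intro hm
      push_cast at hm
      have ih := ih (by omega)
      have a := hf.col hw (m - 1) (by omega) (by omega)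
      have b := hg.col hw (m - 1) (by omega) (by omega)
      rw [C _ (by omega) (by omega), b] at a
      have r0 := R0 (m - 1) (by omega) (by omega)
      have r1 := R0 (m - 1 + 1) (by omega) (by omega)
      have nz := Z hg (m - 1) (by omega) (by omega)
      push_cast
      rw [show (m : ℤ) + 1 - 1 = m - 1 + 1 by ring]
      unfold minor3 at a
      simp only [zero_add] at a
      rw [f0, g0, f1, g1, r0, r1, ← cc] at a
      apply mul_left_cancel₀ nz
      linear_combination a + g 0 (m - 1 + 1) * ih
  have E' : ∀ j : ℤ, -1 ≤ j → j ≤ w →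
      f 2 j - f 2 (w+1) * f 1 j = g 2 j - f 2 (w+1) * g 1 j := by
    intro j ha hb
    have := E (j+1).toNat (by omega)
    rw [Int.toNat_of_nonneg (by omega)] at this
    rwa [show j + 1 - 1 = j by ring] at this
  have B : ∀ m : ℕ, (m : ℤ) ≤ w + 1 → f 1 (m - 1) = g 1 (m - 1) := by
    intro m
    induction m using Nat.strong_induction_on with
    | _ m ih =>
    intro hm
    match m, ih, hm with
    | 0, ih, hm => rw [hf.zero 1 _ (by norm_num), hg.zero 1 _ (by norm_num)]
    | 1, ih, hm => rw [hf.one 1 _ (by norm_num), hg.one 1 _ (by norm_num)]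
    | m+2, ih, hm =>
      push_cast at hm
      have i0 := ih m (by omega) (by omega)
      have i1 := ih (m+1) (by omega) (by push_cast; omega)
      clear ih
      push_cast at *
      rw [show (m : ℤ) + 1 - 1 = m - 1 + 1 by ring] at i1
      rw [show (m : ℤ) + 2 - 1 = m - 1 + 2 by ring]
      generalize hj : (m : ℤ) - 1 = j at *
      have e0 := E' j (by omega) (by omega)
      have e1 := E' (j+1) (by omega) (by omega)
      have e2 := E' (j+2) (by omega) (by omega)
      have r0 := R0 j (by omega) (by omega)
      have r1 := R0 (j+1) (by omega) (by omega)
      have r2 := R0 (j+2) (by omega) (by omega)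
      rw [i0] at e0
      rw [i1] at e1
      have s0 : f 2 j = g 2 j := by linear_combination e0
      have s1 : f 2 (j+1) = g 2 (j+1) := by linear_combination e1
      have a := hf.d3 0 j (by omega) (by omega)
      have b := hg.d3 0 j (by omega) (by omega)
      have p := hg.pos (j+3) (w+1) (by omega) (by omega)
      have q := hg.col hw j (by omega) (by omega)
      have nz : g (j+3) (w+1) ≠ 0 := by omega
      rw [q] at nz
      unfold minor3 at a b nz
      simp only [zero_add] at a b nz
      rw [r0, r1, r2, i0, i1, s0, s1] at a
      rw [g0, g1, ← cc] at nz
      apply mul_left_cancel₀ nz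
      linear_combination a - b - (g 0 j * g 1 (j+1) - g 0 (j+1) * g 1 j) * e2
  have B' : ∀ j : ℤ, -1 ≤ j → j ≤ w → f 1 j = g 1 j := by
    intro j ha hb
    have := B (j+1).toNat (by omega)
    rw [Int.toNat_of_nonneg (by omega)] at this
    rwa [show j + 1 - 1 = j by ring] at this
  refine ⟨R0, ?_, ?_⟩
  · intro j ha hb
    by_cases c1 : j = -2 ∨ j = -1 ∨ j = w + 2 ∨ j = w + 3
    · rw [hf.zero 1 j (by omega), hg.zero 1 j (by omega)]
    by_cases c2 : j = w + 1
    · rw [hf.one 1 j (by omega), hg.one 1 j (by omega)]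
    exact B' j (by omega) (by omega)
  · intro j ha hb
    by_cases c1 : j = -1 ∨ j = 0 ∨ j = w + 3 ∨ j = w + 4
    · rw [hf.zero 2 j (by omega), hg.zero 2 j (by omega)]
    by_cases c2 : j = w + 2
    · rw [hf.one 2 j (by omega), hg.one 2 j (by omega)]
    by_cases c3 : j = w + 1
    · rw [c3, cc]
    have := E' j (by omega) (by omega)
    rw [B' j (by omega) (by omega)] at this
    linear_combination this

theorem minor3_congr {w : ℤ} {f g : ℤ → ℤ → ℤ} {i : ℤ} (a : RowEq w f g i)
    (b : RowEq w f g (i+1)) (c : RowEq w f g (i+2)) (x y z : ℤ)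
    (hx : i - 1 ≤ x ∧ x ≤ i + w + 2) (hy : i - 1 ≤ y ∧ y ≤ i + w + 2)
    (hz : i - 1 ≤ z ∧ z ≤ i + w + 2) : minor3 f i x y z = minor3 g i x y z := by
  unfold minor3
  rw [a x (by omega) (by omega), a y (by omega) (by omega), a z (by omega) (by omega),
    b x (by omega) (by omega), b y (by omega) (by omega), b z (by omega) (by omega),
    c x (by omega) (by omega), c y (by omega) (by omega), c z (by omega) (by omega)]

theorem step_up {w : ℤ} {f g : ℤ → ℤ → ℤ} (hf : Fz w f) (hg : Fz w g) (i : ℤ)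
    (a : RowEq w f g i) (b : RowEq w f g (i+1)) (c : RowEq w f g (i+2)) : RowEq w f g (i+3) := by
  have key : ∀ m : ℕ, (m : ℤ) ≤ w + 2 → f (i+3) (i+m) = g (i+3) (i+m) := by
    intro m
    induction m using Nat.strong_induction_on with
    | _ m ih =>
    intro hm
    match m, ih, hm with
    | 0, ih, hm => rw [hf.zero _ _ (by push_cast; omega), hg.zero _ _ (by push_cast; omega)]
    | 1, ih, hm => rw [hf.zero _ _ (by push_cast; omega), hg.zero _ _ (by push_cast; omega)]
    | 2, ih, hm => rw [hf.one _ _ (by push_cast; omega), hg.one _ _ (by push_cast; omega)]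
    | m+3, ih, hm =>
      push_cast at hm
      have i0 := ih m (by omega) (by omega)
      have i1 := ih (m+1) (by omega) (by push_cast; omega)
      have i2 := ih (m+2) (by omega) (by push_cast; omega)
      clear ih
      push_cast at *
      simp only [← add_assoc] at *
      generalize hj : i + (m : ℤ) = j at *
      have t := hf.d4 i j (by omega) (by omega)
      have s := hg.d4 i j (by omega) (by omega)
      rw [minor3_congr a b c (j+1) (j+2) (j+3) (by omega) (by omega) (by omega),
        minor3_congr a b c j (j+2) (j+3) (by omega) (by omega) (by omega),
        minor3_congr a b c j (j+1) (j+3) (by omega) (by omega) (by omega),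
        hf.d3 i j (by omega) (by omega), i0, i1, i2] at t
      rw [hg.d3 i j (by omega) (by omega)] at s
      linear_combination t - s
  intro j ha hb
  by_cases c1 : j - (i+3) = w + 1 ∨ j - (i+3) = w + 2
  · rw [hf.zero _ _ (by omega), hg.zero _ _ (by omega)]
  by_cases c2 : j - (i+3) = w
  · rw [hf.one _ _ (by omega), hg.one _ _ (by omega)]
  have := key (j - i).toNat (by omega)
  rw [Int.toNat_of_nonneg (by omega)] at this
  rwa [show i + (j - i) = j by ring] at this

theorem step_down {w : ℤ} {f g : ℤ → ℤ → ℤ} (hf : Fz w f) (hg : Fz w g) (i : ℤ)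
    (a : RowEq w f g (i+1)) (b : RowEq w f g (i+2)) (c : RowEq w f g (i+3)) : RowEq w f g i := by
  have key : ∀ m : ℕ, (m : ℤ) ≤ w + 2 → f i (i+w+2-m) = g i (i+w+2-m) := by
    intro m
    induction m using Nat.strong_induction_on with
    | _ m ih =>
    intro hm
    match m, ih, hm with
    | 0, ih, hm => rw [hf.zero _ _ (by push_cast; omega), hg.zero _ _ (by push_cast; omega)]
    | 1, ih, hm => rw [hf.zero _ _ (by push_cast; omega), hg.zero _ _ (by push_cast; omega)]
    | 2, ih, hm => rw [hf.one _ _ (by push_cast; omega), hg.one _ _ (by push_cast; omega)]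
    | m+3, ih, hm =>
      push_cast at hm
      have i0 := ih m (by omega) (by omega)
      have i1 := ih (m+1) (by omega) (by push_cast; omega)
      have i2 := ih (m+2) (by omega) (by push_cast; omega)
      clear ih
      push_cast at *
      obtain ⟨j, hj⟩ : ∃ j, j = i + w + 2 - ((m : ℤ) + 3) := ⟨_, rfl⟩
      rw [← hj]
      rw [show i + w + 2 - (m : ℤ) = j + 3 by omega] at i0
      rw [show i + w + 2 - ((m : ℤ) + 1) = j + 2 by omega] at i1
      rw [show i + w + 2 - ((m : ℤ) + 2) = j + 1 by omega] at i2
      have t := hf.d4 i j (by omega) (by omega)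
      have s := hg.d4 i j (by omega) (by omega)
      have u := hf.d3 (i+1) (j+1) (by omega) (by omega)
      have v := hg.d3 (i+1) (j+1) (by omega) (by omega)
      unfold minor3 at t s u v
      rw [show i + 1 + 1 = i + 2 by ring, show i + 1 + 2 = i + 3 by ring,
        show j + 1 + 1 = j + 2 by ring, show j + 1 + 2 = j + 3 by ring] at u v
      have x0 := a j (by omega) (by omega)
      have x1 := a (j+1) (by omega) (by omega)
      have x2 := a (j+2) (by omega) (by omega)
      have x3 := a (j+3) (by omega) (by omega)
      have y0 := b j (by omega) (by omega)
      have y1 := b (j+1) (by omega) (by omega)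
      have y2 := b (j+2) (by omega) (by omega)
      have y3 := b (j+3) (by omega) (by omega)
      have z0 := c j (by omega) (by omega)
      have z1 := c (j+1) (by omega) (by omega)
      have z2 := c (j+2) (by omega) (by omega)
      have z3 := c (j+3) (by omega) (by omega)
      rw [i0, i1, i2, x0, x1, x2, x3, y0, y1, y2, y3, z0, z1, z2, z3] at t
      linear_combination t - s - (f i j - g i j) * v
  intro j ha hb
  by_cases c1 : j - i = -3 ∨ j - i = -2
  · rw [hf.zero _ _ (by omega), hg.zero _ _ (by omega)]
  by_cases c2 : j - i = -1
  · rw [hf.one _ _ (by omega), hg.one _ _ (by omega)]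
  have := key (i + w + 2 - j).toNat (by omega)
  rw [Int.toNat_of_nonneg (by omega)] at this
  rwa [show i + w + 2 - (i + w + 2 - j) = j by ring] at this

theorem all_rows {w : ℤ} {f g : ℤ → ℤ → ℤ} (hf : Fz w f) (hg : Fz w g)
    (h : RowEq w f g 0 ∧ RowEq w f g 1 ∧ RowEq w f g 2) (i : ℤ) :
    RowEq w f g i ∧ RowEq w f g (i+1) ∧ RowEq w f g (i+2) := by
  induction i using Int.induction_on with
  | zero => simpa using h
  | succ i ih =>
    obtain ⟨a, b, c⟩ := ih
    have d := step_up hf hg _ a b c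
    rw [show (i : ℤ) + 1 + 1 = i + 2 by ring, show (i : ℤ) + 1 + 2 = i + 3 by ring]
    exact ⟨b, c, d⟩
  | pred i ih =>
    obtain ⟨a, b, c⟩ := ih
    have d := step_down hf hg (-(i : ℤ) - 1)
      (by rwa [show -(i : ℤ) - 1 + 1 = -i by ring])
      (by rwa [show -(i : ℤ) - 1 + 2 = -i + 1 by ring])
      (by rwa [show -(i : ℤ) - 1 + 3 = -i + 2 by ring])
    rw [show -(i : ℤ) - 1 + 1 = -i by ring, show -(i : ℤ) - 1 + 2 = -i + 1 by ring]
    exact ⟨d, a, b⟩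

theorem statement7 (n : ℕ) (hn : n = 6 ∨ n = 7 ∨ n = 8) (w : ℕ) (hw : w = n - 4)
    (F F' : SL3Dom w → ℤ) (hF : IsSL3Frieze w F) (hF' : IsSL3Frieze w F')
    (h1 : ∀ j : ℤ, 0 ≤ j → j ≤ (w : ℤ) - 1 → extF w F 0 j = extF w F' 0 j)
    (h2 : ∀ i : ℤ, 2 ≤ i → i ≤ (w : ℤ) + 1 →
      extF w F i ((w : ℤ) + 1) = extF w F' i ((w : ℤ) + 1)) :
    F = F' := by
  have hf := fz_of_frieze w F hF
  have hg := fz_of_frieze w F' hF'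
  have h3 := first_rows hf hg (by omega) h1 h2
  funext p
  obtain ⟨⟨i, j⟩, hp⟩ := p
  have := (all_rows hf hg h3 i).1 j hp.1 hp.2
  have hp' : -3 ≤ j - i ∧ j - i ≤ (w : ℤ) + 2 := hp
  unfold extF at this
  rw [dif_pos hp', dif_pos hp'] at this
  exact this
end

section
/- The set of 2-friezes of height 3 is finite and has exactly 868 elements. -/
/-- A 2-frieze of height `h`: a function `a : ℤ × {0,…,h+1} → ℤ` with `a(i,0) = a(i,h+1) = 1`,
`a(i,j) ≥ 1` for `1 ≤ j ≤ h`, and `a(i,j) = a(i-1,j)·a(i+1,j) - a(i,j-1)·a(i,j+1)`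
for `1 ≤ j ≤ h`. -/
def Is2Frieze (h : ℕ) (a : ℤ → Fin (h + 2) → ℤ) : Prop :=
  (∀ i : ℤ, a i ⟨0, by omega⟩ = 1) ∧
  (∀ i : ℤ, a i ⟨h + 1, by omega⟩ = 1) ∧
  (∀ i : ℤ, ∀ j : ℕ, ∀ _ : 1 ≤ j, ∀ _ : j ≤ h, 1 ≤ a i ⟨j, by omega⟩) ∧
  (∀ i : ℤ, ∀ j : ℕ, ∀ _ : 1 ≤ j, ∀ _ : j ≤ h,
    a i ⟨j, by omega⟩ =
      a (i - 1) ⟨j, by omega⟩ * a (i + 1) ⟨j, by omega⟩ -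
        a i ⟨j - 1, by omega⟩ * a i ⟨j + 1, by omega⟩)

/-- The three inner rows of a 2-frieze of height three. -/
structure FZ (x y z : ℤ → ℤ) : Prop where
  px : ∀ i, 1 ≤ x i
  py : ∀ i, 1 ≤ y i
  pz : ∀ i, 1 ≤ z i
  hx : ∀ i, x (i - 1) * x (i + 1) = x i + y i
  hy : ∀ i, y (i - 1) * y (i + 1) = y i + x i * z i
  hz : ∀ i, z (i - 1) * z (i + 1) = z i + y i

namespace FZ

theorem shift {x y z : ℤ → ℤ} (h : FZ x y z) (k : ℤ) :
    FZ (fun i => x (i + k)) (fun i => y (i + k)) (fun i => z (i + k)) := by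
  refine ⟨fun i => h.px _, fun i => h.py _, fun i => h.pz _, fun i => ?_, fun i => ?_, fun i => ?_⟩
  · have := h.hx (i + k)
    rw [show i + k - 1 = i - 1 + k by ring, show i + k + 1 = i + 1 + k by ring] at this
    exact this
  · have := h.hy (i + k)
    rw [show i + k - 1 = i - 1 + k by ring, show i + k + 1 = i + 1 + k by ring] at this
    exact this
  · have := h.hz (i + k)
    rw [show i + k - 1 = i - 1 + k by ring, show i + k + 1 = i + 1 + k by ring] at this
    exact this

theorem swap {x y z : ℤ → ℤ} (h : FZ x y z) : FZ z y x :=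
  ⟨h.pz, h.py, h.px, h.hz, fun i => by rw [h.hy i]; ring, h.hx⟩

theorem y_eq {x y z : ℤ → ℤ} (h : FZ x y z) (i : ℤ) : y i = x (i - 1) * x (i + 1) - x i := by
  linarith [h.hx i]

/-- The third row is a polynomial in the first row. -/
theorem z_eq {x y z : ℤ → ℤ} (h : FZ x y z) (i : ℤ) :
    z i = x (i - 2) * x i * x (i + 2) - x (i - 2) * x (i + 1) - x (i - 1) * x (i + 2) + 1 := by
  have h1 := h.hx i
  have h2 := h.hx (i - 1)
  have h3 := h.hx (i + 1)
  have h4 := h.hy i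
  rw [show i - 1 - 1 = i - 2 by ring, show i - 1 + 1 = i by ring] at h2
  rw [show i + 1 - 1 = i by ring, show i + 1 + 1 = i + 2 by ring] at h3
  have hp := h.px i
  have h5 : y i = x (i - 1) * x (i + 1) - x i := by linarith
  have h6 : y (i - 1) = x (i - 2) * x i - x (i - 1) := by linarith
  have h7 : y (i + 1) = x i * x (i + 2) - x (i + 1) := by linarith
  rw [h5, h6, h7] at h4
  have : x i ≠ 0 := by omega
  apply mul_left_cancel₀ this
  linear_combination -h4

theorem glide0 {x y z : ℤ → ℤ} (h : FZ x y z) : x 7 = z 0 := by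
  have y1 := h.y_eq 1
  have y2 := h.y_eq 2
  have y3 := h.y_eq 3
  have y4 := h.y_eq 4
  have y5 := h.y_eq 5
  have z2 := h.z_eq 2
  have z3 := h.z_eq 3
  have z4 := h.z_eq 4
  have z5 := h.z_eq 5
  have z6 := h.z_eq 6
  have x2 := h.swap.z_eq 2
  have y3' := h.swap.y_eq 3
  have y1' := h.swap.y_eq 1
  have a3 := h.hz 3
  have a4 := h.hz 4
  have a5 := h.hz 5
  norm_num at y1 y2 y3 y4 y5 z2 z3 z4 z5 z6 x2 y3' y1' a3 a4 a5
  have p3 : y 3 ≠ 0 := by have := h.py 3; omega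
  have p4 : y 4 ≠ 0 := by have := h.py 4; omega
  have p5 : y 5 ≠ 0 := by have := h.py 5; omega
  have q3 : z 3 ≠ 0 := by have := h.pz 3; omega
  have q4 : z 4 ≠ 0 := by have := h.pz 4; omega
  have w3 : x 6 * z 2 - x 5 * y 1 + x 0 = 1 := by
    apply mul_left_cancel₀ p3
    have : z 2 * z 4 - z 3 = y 3 * (x 6 * z 2 - x 5 * y 1 + x 0) := by
      rw [z2, z3, z4, y3, y1]; ring
    linarith
  have w4 : x 7 * z 3 - x 6 * y 2 + x 1 = 1 := by
    apply mul_left_cancel₀ p4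
    have : z 3 * z 5 - z 4 = y 4 * (x 7 * z 3 - x 6 * y 2 + x 1) := by
      rw [z3, z4, z5, y4, y2]; ring
    linarith
  have w5 : x 8 * z 4 - x 7 * y 3 + x 2 = 1 := by
    apply mul_left_cancel₀ p5
    have : z 4 * z 6 - z 5 = y 5 * (x 8 * z 4 - x 7 * y 3 + x 2) := by
      rw [z4, z5, z6, y5, y3]; ring
    linarith
  have u4 : x 8 - x 7 * z 2 + y 1 = 0 := by
    have : z 4 * (x 8 * (x 6 * z 2 - x 5 * y 1 + x 0) - x 7 * z 2 + y 1) =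
        (x 6 * z 2 - x 5 * y 1 + x 0) * (x 8 * z 4 - x 7 * y 3 + x 2)
          - (x 7 * z 3 - x 6 * y 2 + x 1) := by
      rw [z2, z3, z4, y1, y2, y3]; ring
    rw [w3, w4, w5] at this
    have h0 : z 4 * (x 8 - x 7 * z 2 + y 1) = z 4 * 0 := by linarith
    exact mul_left_cancel₀ q4 h0
  have e : z 3 * (x 7 - z 0) = z 3 * 0 := by
    linear_combination (x 7 - z 0) * y3' + w5 - x2 - z 4 * u4 + z 4 * y1' + z 0 * y3'
  have := mul_left_cancel₀ q3 e
  linarith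

theorem glide {x y z : ℤ → ℤ} (h : FZ x y z) (i : ℤ) : x (i + 7) = z i := by
  have := (h.shift i).glide0
  simp only [zero_add] at this
  rw [add_comm]; exact this

theorem per {x y z : ℤ → ℤ} (h : FZ x y z) (i : ℤ) : x (i + 14) = x i := by
  have h1 := h.glide (i + 7)
  have h2 := h.swap.glide i
  rw [show i + 7 + 7 = i + 14 by ring] at h1
  rw [h1, h2]

theorem pery {x y z : ℤ → ℤ} (h : FZ x y z) (i : ℤ) : y (i + 14) = y i := by
  rw [h.y_eq, h.y_eq, h.per, show i + 14 - 1 = i - 1 + 14 by ring,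
    show i + 14 + 1 = i + 1 + 14 by ring, h.per, h.per]

theorem per_mul {f : ℤ → ℤ} (h : ∀ i, f (i + 14) = f i) (i k : ℤ) : f (i + 14 * k) = f i := by
  induction k using Int.induction_on with
  | zero => simp
  | succ n ih => rw [show i + 14 * ((n : ℤ) + 1) = i + 14 * n + 14 by ring, h, ih]
  | pred n ih =>
    rw [← ih, ← h (i + 14 * (-(n : ℤ) - 1))]; congr 1; ring

theorem exists_max {f : ℤ → ℤ} (h : ∀ i, f (i + 14) = f i) : ∃ i, ∀ j, f j ≤ f i := by
  obtain ⟨i, -, hi⟩ := Finset.exists_max_image (Finset.Icc (0 : ℤ) 13) f ⟨0, by simp⟩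
  refine ⟨i, fun j => ?_⟩
  have := hi (j % 14) (by rw [Finset.mem_Icc]; omega)
  rwa [← per_mul h (j % 14) (j / 14), Int.emod_add_mul_ediv] at this

theorem x7_eq {x y z : ℤ → ℤ} (h : FZ x y z) (i : ℤ) :
    x (i + 7) = x (i - 2) * x i * x (i + 2) - x (i - 2) * x (i + 1) - x (i - 1) * x (i + 2) + 1 := by
  rw [h.glide, h.z_eq]

/-- Local structure of the first row at a maximum, when no entry of that row is one. -/
theorem local_max {x y z : ℤ → ℤ} (h : FZ x y z) (h2 : ∀ i, 2 ≤ x i) (hm : ∀ j, x j ≤ x 0) :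
    x 0 = 3 ∧ x (-2) = 2 ∧ x 2 = 2 ∧ ((x 1 = 3 ∧ x (-1) = 2) ∨ (x 1 = 2 ∧ x (-1) = 3)) := by
  obtain ⟨e, he⟩ : ∃ e : ℤ → ℤ, ∀ i, x i = e i + 2 := ⟨fun i => x i - 2, fun i => by ring⟩
  have k0 := h.x7_eq 0
  have k1 := h.x7_eq 1
  have k2 := h.x7_eq (-1)
  norm_num at k0 k1 k2
  have ge : ∀ i, 0 ≤ e i := fun i => by have := h2 i; rw [he] at this; omega
  have le : ∀ i, e i ≤ e 0 := fun i => by have := hm i; rw [he, he 0] at this; omega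
  simp only [he] at k0 k1 k2 ⊢
  have l7 := le 7
  have l8 := le 8
  have l6 := le 6
  have g7 := ge 7
  generalize e 0 = M at *
  have ga := ge (-2)
  have gb := ge (-1)
  have gd := ge 1
  have gf := ge 2
  have gg := ge 3
  have gh := ge (-3)
  have la := le (-2)
  have lb := le (-1)
  have ld := le 1
  have lf := le 2
  generalize e (-2) = a at *
  generalize e (-1) = b at *
  generalize e 1 = d at *
  generalize e 2 = f at *
  generalize e 3 = g at *
  generalize e (-3) = c at *
  generalize e 7 = r7 at *
  generalize e 8 = r8 at *
  generalize e 6 = r6 at *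
  have s1 : 3 * M - 1 + (2 + M) * (a + f) ≤ 2 * b + 2 * d := by
    nlinarith [mul_nonneg ga (sub_nonneg.2 ld), mul_nonneg gf (sub_nonneg.2 lb), mul_nonneg ga gf,
      mul_nonneg (mul_nonneg ga gf) (ga.trans la)]
  have hM : 0 ≤ M := ga.trans la
  have s2 : a + f = 0 := by
    by_contra hne
    have : 1 ≤ a + f := by omega
    nlinarith
  have ha : a = 0 := by omega
  have hf : f = 0 := by omega
  subst ha hf
  have s3 : 3 * M - 1 ≤ 2 * b + 2 * d := by linarith
  have s4 : -1 + 2 * b + 4 * d + 2 * (b * d) ≤ 3 * M := by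
    nlinarith [mul_nonneg gg (show 0 ≤ 2 + 2 * b + 2 * d - M by linarith),
      mul_nonneg gg (mul_nonneg gb gd)]
  have s5 : -1 + 2 * d + 4 * b + 2 * (b * d) ≤ 3 * M := by
    nlinarith [mul_nonneg gh (show 0 ≤ 2 + 2 * b + 2 * d - M by linarith),
      mul_nonneg gh (mul_nonneg gb gd)]
  have s6 : 0 ≤ b * d := mul_nonneg gb gd
  have s7 : M ≤ 1 := by linarith
  have s8 : M ≠ 0 := by
    rintro rfl
    have : b = 0 := by omega
    have : d = 0 := by omega
    subst_vars
    linarith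
  have hM1 : M = 1 := by omega
  subst hM1
  have hb : b = 0 ∨ b = 1 := by omega
  have hd : d = 0 ∨ d = 1 := by omega
  rcases hb with rfl | rfl <;> rcases hd with rfl | rfl <;> simp at s3 s4 s5 ⊢

theorem exists_one {x y z : ℤ → ℤ} (h : FZ x y z) : ∃ i, x i = 1 := by
  by_contra hne
  have h2 : ∀ i, 2 ≤ x i := fun i => by
    have := h.px i
    have : x i ≠ 1 := fun hh => hne ⟨i, hh⟩
    omega
  obtain ⟨m, hm⟩ := exists_max h.per
  have loc : ∀ i, x i = 3 → x (i - 2) = 2 ∧ x (i + 2) = 2 ∧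
      ((x (i + 1) = 3 ∧ x (i - 1) = 2) ∨ (x (i + 1) = 2 ∧ x (i - 1) = 3)) := by
    have h3 : x m = 3 := by
      have := (h.shift m).local_max (fun i => h2 _) (fun j => by simpa using hm (j + m))
      simpa using this.1
    intro i hi
    have := (h.shift i).local_max (fun i => h2 _)
      (fun j => by simpa [hi, h3] using hm (j + i))
    simp only [zero_add] at this
    rw [sub_eq_add_neg, sub_eq_add_neg, add_comm i, add_comm i, add_comm i, add_comm i]
    exact this.2
  have h3 : x m = 3 := by
    have := (h.shift m).local_max (fun i => h2 _) (fun j => by simpa using hm (j + m))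
    simpa using this.1
  -- a pair of adjacent threes
  obtain ⟨n, hn0, hn1⟩ : ∃ n, x n = 3 ∧ x (n + 1) = 3 := by
    rcases (loc m h3).2.2 with hh | hh
    · exact ⟨m, h3, hh.1⟩
    · exact ⟨m - 1, hh.2, by simpa using h3⟩
  have l0 := loc n hn0
  have l1 := loc (n + 1) hn1
  rw [show n + 1 - 2 = n - 1 by ring, show n + 1 + 2 = n + 3 by ring,
    show n + 1 + 1 = n + 2 by ring] at l1
  have k0 := h.x7_eq n
  have k1 := h.x7_eq (n + 1)
  have k2 := h.x7_eq (n + 2)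
  rw [show n + 1 - 2 = n - 1 by ring, show n + 1 + 2 = n + 3 by ring,
    show n + 1 + 1 = n + 2 by ring, show n + 1 - 1 = n by ring,
    show n + 1 + 7 = n + 8 by ring] at k1
  rw [show n + 2 - 2 = n by ring, show n + 2 + 2 = n + 4 by ring,
    show n + 2 + 1 = n + 3 by ring, show n + 2 - 1 = n + 1 by ring,
    show n + 2 + 7 = n + 9 by ring] at k2
  have e0 : x (n + 2) = 2 := l0.2.1
  have e1 : x (n - 1) = 2 := l1.1
  have e2 : x (n + 3) = 2 := l1.2.1
  have e3 : x (n - 2) = 2 := l0.1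
  rw [e3, e0, e1, hn0, hn1] at k0
  have k7 : x (n + 7) = 3 := by rw [k0]; norm_num
  have l7 := loc (n + 7) k7
  rw [show n + 7 + 2 = n + 9 by ring] at l7
  rw [l7.2.1, hn0, hn1, e0, e2] at k2
  omega

end FZ

theorem cyc2 {a b k l : ℤ} (ha : 1 ≤ a) (hb : 1 ≤ b) (h1 : k * a = 2 * b) (h2 : l * b = 2 * a) :
    k + l ≤ 5 := by
  have hk : 1 ≤ k := by by_contra hh; nlinarith
  have hl : 1 ≤ l := by by_contra hh; nlinarith
  have h : k * l = 4 := by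
    have hab : a * b ≠ 0 := by positivity
    apply mul_right_cancel₀ hab
    linear_combination (l * b) * h1 + (2 * b) * h2
  nlinarith [mul_nonneg (sub_nonneg.2 hk) (sub_nonneg.2 hl)]

theorem one_or_two {a b e k : ℤ} (hb : 1 ≤ b) (he : 1 ≤ e) (h : k * a = b + e)
    (hba : b ≤ a) (hea : e ≤ a) : (k = 1 ∧ a = b + e) ∨ (k = 2 ∧ b = a ∧ e = a) := by
  have h1 : 1 ≤ k := by by_contra hh; nlinarith
  have h2 : k ≤ 2 := by by_contra hh; nlinarith
  have : k = 1 ∨ k = 2 := by omega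
  rcases this with rfl | rfl
  · left; constructor <;> linarith
  · right; refine ⟨rfl, ?_, ?_⟩ <;> linarith

theorem next_eq {a c k : ℤ} (hc : 1 ≤ c) (h : k * a = a + c) (hca : c ≤ a) : c = a ∧ k = 2 := by
  have h1 : 2 ≤ k := by by_contra hh; nlinarith
  have h2 : k ≤ 2 := by by_contra hh; nlinarith
  obtain rfl : k = 2 := by omega
  exact ⟨by linarith, rfl⟩

theorem cyc3a {a b c k l m : ℤ} (hb : 1 ≤ b) (hc : 1 ≤ c)
    (h1 : k * a = b + c) (h2 : l * b = c + a) (h3 : m * c = a + b) (hba : b ≤ a) (hca : c ≤ a) :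
    k + l + m ≤ 8 := by
  rcases one_or_two hb hc h1 hba hca with ⟨rfl, rfl⟩ | ⟨rfl, rfl, rfl⟩
  · have := cyc2 (k := l - 1) (l := m - 1) hb hc (by linarith) (by linarith)
    linarith
  · have := next_eq hb h2 hba
    have := next_eq hb h3 hba
    omega

theorem cyc3 {a b c k l m : ℤ} (ha : 1 ≤ a) (hb : 1 ≤ b) (hc : 1 ≤ c)
    (h1 : k * a = b + c) (h2 : l * b = c + a) (h3 : m * c = a + b) : k + l + m ≤ 8 := by
  by_cases hA : b ≤ a ∧ c ≤ a
  · exact cyc3a hb hc h1 h2 h3 hA.1 hA.2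
  by_cases hB : c ≤ b ∧ a ≤ b
  · linarith [cyc3a hc ha h2 h3 h1 hB.1 hB.2]
  · linarith [cyc3a ha hb h3 h1 h2 (by omega) (by omega)]

theorem cyc4a {a b c d k l m n : ℤ} (hb : 1 ≤ b) (hc : 1 ≤ c) (hd : 1 ≤ d)
    (h1 : k * a = b + d) (h2 : l * b = c + a) (h3 : m * c = d + b) (h4 : n * d = a + c)
    (hba : b ≤ a) (hca : c ≤ a) (hda : d ≤ a) : k + l + m + n ≤ 11 := by
  rcases one_or_two hb hd h1 hba hda with ⟨rfl, rfl⟩ | ⟨rfl, rfl, rfl⟩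
  · have := cyc3 (k := l - 1) (l := m) (m := n - 1) hb hc hd (by linarith) (by linarith)
      (by linarith)
    linarith
  · obtain ⟨rfl, rfl⟩ := next_eq (k := l) hc (by linarith) hca
    obtain ⟨-, rfl⟩ := next_eq hc h3 hca
    obtain ⟨-, rfl⟩ := next_eq hc h4 hca
    norm_num

theorem cyc4 {a b c d k l m n : ℤ} (ha : 1 ≤ a) (hb : 1 ≤ b) (hc : 1 ≤ c) (hd : 1 ≤ d)
    (h1 : k * a = b + d) (h2 : l * b = c + a) (h3 : m * c = d + b) (h4 : n * d = a + c) :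
    k + l + m + n ≤ 11 := by
  by_cases hA : b ≤ a ∧ c ≤ a ∧ d ≤ a
  · exact cyc4a hb hc hd h1 h2 h3 h4 hA.1 hA.2.1 hA.2.2
  by_cases hB : c ≤ b ∧ d ≤ b ∧ a ≤ b
  · linarith [cyc4a hc hd ha h2 h3 h4 h1 hB.1 hB.2.1 hB.2.2]
  by_cases hC : d ≤ c ∧ a ≤ c ∧ b ≤ c
  · linarith [cyc4a hd ha hb h3 h4 h1 h2 hC.1 hC.2.1 hC.2.2]
  · linarith [cyc4a ha hb hc h4 h1 h2 h3 (by omega) (by omega) (by omega)]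

theorem cyc5a {a b c d e k l m n o : ℤ} (hb : 1 ≤ b) (hc : 1 ≤ c) (hd : 1 ≤ d) (he : 1 ≤ e)
    (h1 : k * a = b + e) (h2 : l * b = c + a) (h3 : m * c = d + b) (h4 : n * d = e + c)
    (h5 : o * e = a + d) (hba : b ≤ a) (hca : c ≤ a) (hda : d ≤ a) (hea : e ≤ a) :
    k + l + m + n + o ≤ 14 := by
  rcases one_or_two hb he h1 hba hea with ⟨rfl, rfl⟩ | ⟨rfl, rfl, rfl⟩
  · have := cyc4 (k := l - 1) (l := m) (m := n) (n := o - 1) hb hc hd he (by linarith)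
      (by linarith) (by linarith) (by linarith)
    linarith
  · obtain ⟨rfl, rfl⟩ := next_eq (k := l) hc (by linarith) hca
    obtain ⟨rfl, rfl⟩ := next_eq (k := m) hd (by linarith) hda
    obtain ⟨-, rfl⟩ := next_eq hc h4 le_rfl
    obtain ⟨-, rfl⟩ := next_eq hc h5 le_rfl
    norm_num

theorem cyc5 {a b c d e k l m n o : ℤ} (ha : 1 ≤ a) (hb : 1 ≤ b) (hc : 1 ≤ c) (hd : 1 ≤ d)
    (he : 1 ≤ e)
    (h1 : k * a = b + e) (h2 : l * b = c + a) (h3 : m * c = d + b) (h4 : n * d = e + c)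
    (h5 : o * e = a + d) : k + l + m + n + o ≤ 14 := by
  by_cases hA : b ≤ a ∧ c ≤ a ∧ d ≤ a ∧ e ≤ a
  · exact cyc5a hb hc hd he h1 h2 h3 h4 h5 hA.1 hA.2.1 hA.2.2.1 hA.2.2.2
  by_cases hB : c ≤ b ∧ d ≤ b ∧ e ≤ b ∧ a ≤ b
  · linarith [cyc5a hc hd he ha h2 h3 h4 h5 h1 hB.1 hB.2.1 hB.2.2.1 hB.2.2.2]
  by_cases hC : d ≤ c ∧ e ≤ c ∧ a ≤ c ∧ b ≤ c
  · linarith [cyc5a hd he ha hb h3 h4 h5 h1 h2 hC.1 hC.2.1 hC.2.2.1 hC.2.2.2]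
  by_cases hD : e ≤ d ∧ a ≤ d ∧ b ≤ d ∧ c ≤ d
  · linarith [cyc5a he ha hb hc h4 h5 h1 h2 h3 hD.1 hD.2.1 hD.2.2.1 hD.2.2.2]
  · linarith [cyc5a ha hb hc hd h5 h1 h2 h3 h4 (by omega) (by omega) (by omega) (by omega)]

/-- The bounds on a frieze with a one in the first row. -/
theorem FZ.bounds {x y z : ℤ → ℤ} (h : FZ x y z) (h0 : x 0 = 1) :
    ∃ p r' t' : ℤ, 1 ≤ p ∧ p + x 1 + z 0 ≤ 12 ∧ y 0 = p * x 1 - 1 ∧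
      y 1 * r' = z 0 + p * x 1 - 1 ∧ z 1 * t' = z 0 + p * x 1 - 1 := by
  have y0 := h.y_eq 0
  have y1 := h.y_eq 1
  have y2 := h.y_eq 2
  have z1 := h.z_eq 1
  have z2 := h.z_eq 2
  have a1 := h.hz 1
  have a2 := h.hz 2
  have a0 := h.hz 0
  have b0 := h.hy 0
  norm_num at y0 y1 y2 z1 z2 a1 a2 a0 b0
  rw [h0] at y0 y1 z1 z2 b0
  have q1 := h.px 1
  have q4 := h.px 4
  have q3 := h.pz 3
  have m1 := h.py 1
  have m2 := h.py 2
  have e5 : x 1 * (x 3 - 1) = y 1 + y 2 := by rw [y1, y2]; ring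
  have e3 : 1 ≤ x 3 - 1 := by
    by_contra hh
    nlinarith
  have key := cyc5 (a := y 1) (b := z 2) (c := z 1) (d := y 2) (e := x 3 - 1)
    (k := x 4) (l := z 0) (m := z 3) (n := x (-1)) (o := x 1) m1 (h.pz 2) (h.pz 1) m2 e3
    (by rw [y1, z2]; ring) (by linarith) (by linarith) (by rw [y2, z1]; ring) (by linarith)
  refine ⟨x (-1), y (-1), z (-1), h.px _, by linarith, y0, ?_, ?_⟩
  · linarith
  · linarith

/-- Two consecutive columns. -/
structure St where
  x : ℕ
  y : ℕ
  z : ℕ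
  u : ℕ
  v : ℕ
  w : ℕ

def St.next (s : St) : St :=
  ⟨s.u, s.v, s.w, (s.u + s.v) / s.x, (s.v + s.u * s.w) / s.y, (s.w + s.v) / s.z⟩

def St.ok (s : St) : Bool :=
  Nat.beq ((s.u + s.v) % s.x) 0 && (Nat.beq ((s.v + s.u * s.w) % s.y) 0 &&
    Nat.beq ((s.w + s.v) % s.z) 0)

def St.pos (s : St) : Bool :=
  Nat.ble 1 s.x && (Nat.ble 1 s.y && Nat.ble 1 s.z)

def St.small (s : St) : Bool :=
  Nat.ble s.x 31 && (Nat.ble s.y 31 && (Nat.ble s.z 31 &&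
    (Nat.ble s.u 31 && (Nat.ble s.v 31 && Nat.ble s.w 31))))

def St.code (s : St) : ℕ :=
  ((((s.x * 32 + s.y) * 32 + s.z) * 32 + s.u) * 32 + s.v) * 32 + s.w

def decode (c : ℕ) : St :=
  ⟨c / 33554432, c / 1048576 % 32, c / 32768 % 32, c / 1024 % 32, c / 32 % 32, c % 32⟩

theorem decode_code (s : St) (h : s.small = true) : decode s.code = s := by
  obtain ⟨x, y, z, u, v, w⟩ := s
  simp only [St.small, Bool.and_eq_true, Nat.ble_eq] at h
  simp only [decode, St.code, St.mk.injEq]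
  omega

def valid : ℕ → St → Bool
  | 0, _ => true
  | n + 1, s => s.ok && valid n s.next

/-- Binary search trees. -/
inductive Tr where
  | e : Tr
  | n : Tr → ℕ → Tr → Tr

def Tr.mem (c : ℕ) : Tr → Bool
  | .e => false
  | .n l v r => bif Nat.beq c v then true else bif Nat.ble c v then l.mem c else r.mem c

def Tr.toList : Tr → List ℕ
  | .e => []
  | .n l v r => l.toList ++ v :: r.toList

theorem Tr.mem_toList (c : ℕ) (t : Tr) (h : t.mem c = true) : c ∈ t.toList := by
  induction t with
  | e => simp [Tr.mem] at h
  | n l v r ihl ihr =>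
    simp only [Tr.mem, Bool.cond_eq_ite] at h
    simp only [Tr.toList, List.mem_append, List.mem_cons]
    split_ifs at h with h1 h2
    · right; left; exact Nat.eq_of_beq_eq_true h1
    · exact Or.inl (ihl h)
    · exact Or.inr (Or.inr (ihr h))

def inTree (t : Tr) : ℕ → St → Bool
  | 0, _ => true
  | n + 1, s => (s.small && t.mem s.code) && inTree t n s.next

/-- Strictly increasing above a bound. -/
def incr : ℕ → List ℕ → Bool
  | _, [] => true
  | b, c :: l => Nat.blt b c && incr c l

theorem incr_lt (l : List ℕ) : ∀ b, incr b l = true → ∀ c ∈ l, b < c := by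
  induction l with
  | nil => simp
  | cons a l ih =>
    intro b h c hc
    simp only [incr, Bool.and_eq_true, Nat.blt_eq] at h
    rcases List.mem_cons.1 hc with rfl | hc
    · exact h.1
    · exact h.1.trans (ih a h.2 c hc)

theorem incr_nodup (l : List ℕ) : ∀ b, incr b l = true → l.Nodup := by
  induction l with
  | nil => simp
  | cons a l ih =>
    intro b h
    simp only [incr, Bool.and_eq_true, Nat.blt_eq] at h
    rw [List.nodup_cons]
    exact ⟨fun ha => (incr_lt l a h.2 a ha).false, ih a h.2⟩

def goodRun : ℕ → St → Bool
  | 0, _ => true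
  | n + 1, s => (s.pos && s.ok) && goodRun n s.next

/-- A code of an honest frieze. -/
def good (c : ℕ) : Bool :=
  (decode c).small && (goodRun 14 (decode c) && (Nat.beq (decode c).code c &&
    ((St.next^[14] (decode c)).small && Nat.beq (St.next^[14] (decode c)).code c)))

def cand (t : Tr) (p q m r s : ℕ) : Bool :=
  bif valid 14 ⟨1, p * q - 1, m, q, r, s⟩ then inTree t 14 ⟨1, p * q - 1, m, q, r, s⟩ else true

def search (t : Tr) : Bool :=
  (List.range 11).all fun p => (List.range 11).all fun q => (List.range 11).all fun m =>
    bif Nat.ble (p + q + m) 12 && (Nat.ble 1 p && (Nat.ble 1 q && Nat.ble 1 m)) then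
      (List.range 40).all fun r =>
        bif Nat.beq ((m + p * q - 1) % r) 0 then
          (List.range 40).all fun s =>
            bif Nat.beq ((m + p * q - 1) % s) 0 then cand t p q m r s else true
        else true
    else true

namespace Tr

/-- The codes of all friezes. -/
def codes : Tr :=
  (n (n (n (n (n (n (n (n (n (n e 34636833
  e) 34636834
  (n e 34636865
  e)) 34636866
  (n (n e 34637857
  e) 34637858
  e)) 34637889
  (n (n (n e 34637890
  e) 34669601
  (n e 34669603
  e)) 34669665
  (n (n e 34669667
  e) 34670625
  e))) 34670627
  (n (n (n (n e 34670689
  e) 34670691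
  (n e 34702370
  e)) 34702401
  (n (n e 34702404
  e) 34702466
  e)) 34703394
  (n (n (n e 34703425
  e) 34703428
  (n e 34703490
  e)) 34767939
  (n (n e 34767970
  e) 34768963
  e)))) 34768994
  (n (n (n (n (n e 35685409
  e) 35685411
  (n e 35685473
  e)) 35685475
  (n (n e 35687457
  e) 35687459
  e)) 35687521
  (n (n (n e 35687523
  e) 35718177
  (n e 35718210
  e)) 35718276
  (n (n e 35720225
  e) 35720258
  e))) 35720324
  (n (n (n (n e 35750949
  e) 35751073
  (n e 35752997
  e)) 35753121
  (n (n e 35783715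
  e) 35783750
  e)) 35783777
  (n (n (n e 35783874
  e) 35785763
  e) 35785798
  (n (n e 35785825
  e) 35785922
  e))))) 35849284
  (n (n (n (n (n (n e 35849346
  e) 35851332
  (n e 35851394
  e)) 36733986
  (n (n e 36734017
  e) 36734020
  e)) 36734082
  (n (n (n e 36735009
  e) 36735012
  (n e 36735042
  e)) 36735105
  (n (n e 36735108
  e) 36737058
  e))) 36737089
  (n (n (n (n e 36737092
  e) 36737154
  (n e 36766757
  e)) 36766881
  (n (n e 36767777
  e) 36767909
  e)) 36769829
  (n (n (n e 36769953
  e) 36799522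
  e) 36799553
  (n (n e 36799590
  e) 36799683
  e)))) 36802594
  (n (n (n (n (n e 36802625
  e) 36802662
  (n e 36802755
  e)) 36833319
  (n (n e 36833505
  e) 36866084
  e)) 36866120
  (n (n (n e 36866177
  e) 36866306
  (n e 36897891
  e)) 36900963
  (n (n e 36931653
  e) 36931746
  e))) 37815331
  (n (n (n (n e 37815366
  e) 37815393
  (n e 37815490
  e)) 37819427
  (n (n e 37819462
  e) 37819489
  e)) 37819586
  (n (n (n e 37880898
  e) 37880964
  e) 37884994
  (n (n e 37885060
  e) 38831171
  e)))))) 38831202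
  (n (n (n (n (n (n (n e 38832162
  e) 38832225
  (n e 38832230
  e)) 38832322
  (n (n e 38833187
  e) 38833217
  e)) 38833222
  (n (n (n e 38833347
  e) 38836291
  (n e 38836322
  e)) 38864935
  (n (n e 38866145
  e) 38897698
  e))) 38897732
  (n (n (n (n e 38897800
  e) 38897921
  (n e 38898728
  e)) 38898753
  (n (n e 38898818
  e) 38898948
  e)) 38930529
  (n (n (n e 38930723
  e) 38931491
  (n e 38931561
  e)) 39028867
  (n (n e 39029860
  e) 39912516
  e)))) 39912578
  (n (n (n (n (n e 39918660
  e) 39918722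
  (n e 39945315
  e)) 39951459
  (n (n e 40962083
  e) 40962153
  e)) 40964193
  (n (n (n e 40964387
  e) 40994977
  (n e 40995138
  e)) 40996901
  (n (n e 40996938
  e) 41060450
  e))) 41060548
  (n (n (n (n e 41062467
  e) 41062534
  (n e 42011685
  e)) 42011722
  (n (n e 42011809
  e) 42011970
  e)) 42077250
  (n (n (n e 42077382
  e) 43026594
  e) 43029573
  (n (n e 45123684
  e) 45124675
  e))))) 45124742
  (n (n (n (n (n (n e 45125730
  e) 45125828
  (n e 45127811
  e)) 45189346
  (n (n e 45193287
  e) 45222051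
  e)) 45226085
  (n (n (n e 47253605
  e) 47258787
  (n e 48270499
  e)) 48272485
  (n (n e 48303172
  e) 48303240
  e))) 48303362
  (n (n (n (n e 48305224
  e) 48305282
  (n e 48305412
  e)) 49385571
  (n (n e 49385670
  e) 51481764
  e)) 51484805
  (n (n (n e 53547235
  e) 53548135
  e) 68191265
  (n (n e 68191266
  e) 68191329
  e)))) 68191330
  (n (n (n (n (n e 68193313
  e) 68193314
  (n e 68193377
  e)) 68193378
  (n (n e 68224033
  e) 68224035
  e)) 68224161
  (n (n (n e 68224163
  e) 68226081
  (n e 68226083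
  e)) 68226209
  (n (n e 68226211
  e) 68256802
  e))) 68256994
  (n (n (n (n e 68258850
  e) 68259042
  (n e 68289633
  e)) 68289637
  (n (n e 68291681
  e) 68291685
  e)) 68387940
  (n (n (n e 68388002
  e) 68389988
  e) 68390050
  (n (n e 69239841
  e) 69239843
  e))))))) 69240897
  (n (n (n (n (n (n (n (n e 69240899
  e) 69243009
  (n e 69243011
  e)) 69272609
  (n (n e 69272673
  e) 69275716
  e)) 69275844
  (n (n (n e 69305381
  e) 69306433
  (n e 69306501
  e)) 69308673
  (n (n e 69338147
  e) 69338275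
  e))) 69341250
  (n (n (n (n e 69341506
  e) 69370983
  (n e 69374081
  e)) 69437571
  (n (n e 69469285
  e) 69472450
  e)) 70288418
  (n (n (n e 70288545
  e) 70288548
  (n e 70292513
  e)) 70292516
  (n (n e 70292642
  e) 70321189
  e)))) 70321381
  (n (n (n (n (n e 70325281
  e) 70325473
  (n e 70353954
  e)) 70358307
  (n (n e 70387041
  e) 70390823
  e)) 70419874
  (n (n (n e 70423588
  e) 70452385
  (n e 70456425
  e)) 70550754
  (n (n e 70554726
  e) 71337057
  e))) 71337061
  (n (n (n (n e 71338177
  e) 71338181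
  (n e 71339041
  e)) 71339045
  (n (n e 71342145
  e) 71342149
  e)) 71369763
  (n (n (n e 71371014
  e) 71371809
  e) 71375106
  (n (n e 71402663
  e) 71403591
  e))))) 71404705
  (n (n (n (n (n (n e 71407681
  e) 71435361
  (n e 71440520
  e)) 71469123
  (n (n e 71469505
  e) 71470121
  e)) 71470307
  (n (n (n e 71502338
  e) 71502885
  (n e 71534785
  e)) 71535723
  (n (n e 71566499
  e) 71571588
  e))) 71633154
  (n (n (n (n e 71634023
  e) 72385763
  (n e 72391714
  e)) 72418407
  (n (n e 72418593
  e) 72424487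
  e)) 72424545
  (n (n (n e 72451428
  e) 72457250
  e) 72516706
  (n (n e 72522917
  e) 73435265
  e)))) 73435271
  (n (n (n (n (n e 73437249
  e) 73437255
  (n e 73467041
  e)) 73474120
  (n (n e 73500873
  e) 73502785
  e)) 73532645
  (n (n (n e 73539650
  e) 73566337
  (n e 73568395
  e)) 73697475
  (n (n e 73699461
  e) 74482788
  e))) 74484770
  (n (n (n (n e 74485028
  e) 74490978
  (n e 74515811
  e)) 74517545
  (n (n e 74517857
  e) 74523683
  e)) 74550306
  (n (n (n e 74550693
  e) 75531427
  e) 75532611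
  (n (n e 75535395
  e) 75540547
  e)))))) 75564133
  (n (n (n (n (n (n (n e 75565194
  e) 75568225
  (n e 75573378
  e)) 75598273
  (n (n e 75600939
  e) 75631108
  e)) 75633699
  (n (n (n e 75696258
  e) 75699367
  (n e 76645540
  e)) 76655715
  (n (n e 77661411
  e) 77663267
  e))) 77663457
  (n (n (n (n e 77664332
  e) 77664708
  (n e 77672516
  e)) 77695233
  (n (n e 77699149
  e) 77729063
  e)) 77729858
  (n (n (n e 77760837
  e) 77764675
  e) 79792707
  (n (n e 79797285
  e) 80776359
  e)))) 80778338
  (n (n (n (n (n e 80809507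
  e) 80811045
  (n e 81823877
  e)) 81824003
  (n (n e 81825859
  e) 81826053
  e)) 81829957
  (n (n (n e 81830019
  e) 83953798
  (n e 83954857
  e)) 83957890
  (n (n e 83960995
  e) 84019460
  e))) 84026469
  (n (n (n (n e 86052932
  e) 86054245
  (n e 86083971
  e)) 86085895
  (n (n e 86086755
  e) 86091847
  e)) 87067876
  (n (n (n e 87071845
  e) 90246563
  e) 90251336
  (n (n e 90279141
  e) 90284165
  e))))) 94441796
  (n (n (n (n (n (n e 94444647
  e) 101745729
  (n e 101745730
  e)) 101746721
  (n (n e 101746722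
  e) 101746817
  e)) 101746818
  (n (n (n e 101748801
  e) 101748802
  (n e 101779489
  e)) 101779491
  (n (n e 101779681
  e) 101779683
  e))) 101811265
  (n (n (n (n e 101811268
  e) 101811361
  (n e 101811364
  e)) 101812258
  (n (n e 101812546
  e) 101814337
  e)) 101814340
  (n (n (n e 101814433
  e) 101814436
  e) 101876803
  (n (n e 101876994
  e) 101877889
  e)))) 101877894
  (n (n (n (n (n e 101879875
  e) 101880066
  (n e 101975203
  e)) 101978275
  (n (n e 102008965
  e) 102009058
  e)) 102794401
  (n (n (n e 102794403
  e) 102798369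
  (n e 102798371
  e)) 102827074
  (n (n e 102827268
  e) 102831137
  e))) 102831234
  (n (n (n (n e 102860129
  e) 102863909
  (n e 102892614
  e)) 102892994
  (n (n e 102896675
  e) 102896865
  e)) 102958148
  (n (n (n e 102958241
  e) 102962312
  e) 102962498
  (n (n e 103089410
  e) 103093382
  e)))))))) 103842881
  (n (n (n (n (n (n (n (n (n e 103842884
  e) 103843873
  (n e 103843876
  e)) 103845057
  (n (n e 103845060
  e) 103848033
  e)) 103848036
  (n (n (n e 103876641
  e) 103877925
  (n e 103908417
  e)) 103913670
  (n (n e 103941287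
  e) 103942183
  e))) 103943649
  (n (n (n (n e 103946337
  e) 103974948
  (n e 103976514
  e)) 104040586
  (n (n e 104041665
  e) 104105124
  e)) 104110275
  (n (n (n e 104171655
  e) 104172834
  (n e 104924230
  e)) 104924323
  (n (n e 104930370
  e) 104930465
  e)))) 104989762
  (n (n (n (n (n e 104996100
  e) 105055585
  (n e 105061450
  e)) 105121218
  (n (n e 105126982
  e) 105940035
  e)) 105940226
  (n (n (n e 105941026
  e) 105941123
  (n e 105943106
  e)) 105943299
  (n (n e 105947171
  e) 105947266
  e))) 105973799
  (n (n (n (n e 105976161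
  e) 106005953
  (n e 106006562
  e)) 106009028
  (n (n e 106012712
  e) 106038819
  e)) 106045475
  (n (n (n e 106138017
  e) 106139724
  e) 106203650
  (n (n e 106205255
  e) 106990689
  e))))) 106990695
  (n (n (n (n (n (n e 107021380
  e) 107029698
  (n e 107054241
  e)) 107062377
  (n (n e 107088993
  e) 107089098
  e)) 107152644
  (n (n (n e 107160675
  e) 107285700
  (n e 108037282
  e)) 108038466
  (n (n e 108041252
  e) 108046404
  e))) 108070947
  (n (n (n (n e 108074403
  e) 108103813
  (n e 108106882
  e)) 108137057
  (n (n e 108139563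
  e) 108169923
  e)) 108172324
  (n (n (n e 109118914
  e) 109128741
  e) 109184163
  (n (n e 109194372
  e) 110169195
  e)))) 110170273
  (n (n (n (n (n e 110202147
  e) 110202948
  (n e 110233825
  e)) 110237805
  (n (n e 110267490
  e) 110268679
  e)) 110332228
  (n (n (n e 110336100
  e) 111215874
  (n e 111227974
  e)) 112232674
  (n (n e 112237638
  e) 113315394
  e))) 113316903
  (n (n (n (n e 114395842
  e) 114401320
  (n e 114460899
  e)) 114466950
  (n (n e 116427876
  e) 116431044
  e)) 118526115
  (n (n (n e 118527110
  e) 118589858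
  e) 118597706
  (n (n e 119606373
  e) 119606658
  e)))))) 119610442
  (n (n (n (n (n (n (n e 119610628
  e) 122785956
  (n e 122788038
  e)) 123802760
  (n (n e 123802851
  e) 135332961
  e)) 135332963
  (n (n (n e 135337057
  e) 135337059
  (n e 135431266
  e)) 135431395
  (n (n e 135435362
  e) 135435491
  e))) 136348769
  (n (n (n (n e 136348771
  e) 136349889
  (n e 136349891
  e)) 136350753
  (n (n e 136350755
  e) 136353857
  e)) 136353859
  (n (n (n e 136382532
  e) 136382788
  e) 136383521
  (n (n e 136383649
  e) 136414437
  e)))) 136415681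
  (n (n (n (n (n e 136416293
  e) 136419393
  (n e 136447073
  e)) 136448066
  (n (n e 136448578
  e) 136449059
  e)) 136449315
  (n (n (n e 136452294
  e) 136546497
  (n e 136547497
  e)) 136643811
  (n (n e 136648900
  e) 136710466
  e))) 136711335
  (n (n (n (n e 137397474
  e) 137403426
  (n e 137430369
  e)) 137436197
  (n (n e 137462886
  e) 137463267
  e)) 137468962
  (n (n (n e 137469089
  e) 137561187
  e) 137567523
  (n (n e 138446913
  e) 138446917
  e))))) 138449025
  (n (n (n (n (n (n e 138449029
  e) 138478689
  (n e 138485894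
  e)) 138512449
  (n (n e 138514695
  e) 138578121
  e)) 138580097
  (n (n (n e 138609893
  e) 138616962
  (n e 138774725
  e)) 138776835
  (n (n e 139494498
  e) 139496483
  e))) 139496738
  (n (n (n (n e 139502691
  e) 139562024
  (n e 139562529
  e)) 139594787
  (n (n e 139595427
  e) 140576840
  e)) 140580065
  (n (n (n e 140608611
  e) 140617923
  e) 140641633
  (n (n e 140642370
  e) 140645733
  e)))) 140650570
  (n (n (n (n (n e 140707299
  e) 140716100
  (n e 141657698
  e)) 141667365
  (n (n e 142641219
  e) 142645443
  e)) 142674981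
  (n (n (n e 142676482
  e) 142707873
  (n e 142708875
  e)) 142772673
  (n (n e 142776397
  e) 142838339
  e))) 142839077
  (n (n (n (n e 142839939
  e) 142841925
  (n e 143754466
  e)) 143766630
  (n (n e 144771140
  e) 144776483
  e)) 144837442
  (n (n (n e 144841767
  e) 145788066
  e) 145790054
  (n (n e 149031234
  e) 149032099
  e))))))) 149035206
  (n (n (n (n (n (n (n (n e 149038185
  e) 151064834
  (n e 151065705
  e)) 168855649
  (n (n e 168855650
  e) 168856641
  e)) 168856642
  (n (n (n e 168920194
  e) 168921345
  (n e 168921348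
  e)) 168922177
  (n (n e 168922180
  e) 168925314
  e))) 168953953
  (n (n (n (n e 168953957
  e) 168955105
  (n e 168955109
  e)) 168987042
  (n (n e 168987715
  e) 169052260
  e)) 169053570
  (n (n (n e 169183491
  e) 169184484
  (n e 169936004
  e)) 169942113
  (n (n e 170034465
  e) 170040423
  e)))) 170067074
  (n (n (n (n (n e 170073348
  e) 170132930
  (n e 170138725
  e)) 170951810
  (n (n e 170952962
  e) 170954786
  e)) 170958914
  (n (n (n e 170985889
  e) 170987557
  (n e 171018819
  e)) 171020322
  (n (n e 171083201
  e) 171089992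
  e))) 171116649
  (n (n (n (n e 171118945
  e) 171148898
  (n e 171155525
  e)) 171214950
  (n (n e 171217410
  e) 172033474
  e)) 172035138
  (n (n (n e 172035299
  e) 172041251
  e) 172098692
  (n (n e 172106946
  e) 172166218
  e))))) 172166689
  (n (n (n (n (n (n e 172231750
  e) 172232386
  (n e 173082721
  e)) 173085863
  (n (n e 173246726
  e) 173249698
  e)) 174130306
  (n (n (n e 174140548
  e) 175147106
  (n e 175148100
  e)) 175149250
  (n (n e 175151236
  e) 175214274
  e))) 175214629
  (n (n (n (n e 176293314
  e) 176305222
  (n e 177309795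
  e)) 177315076
  (n (n e 178326598
  e) 178328898
  e)) 179472962
  (n (n (n e 179474628
  e) 179478600
  e) 181505250
  (n (n e 181508232
  e) 203458689
  e)))) 203458691
  (n (n (n (n (n e 203460673
  e) 203460675
  (n e 203523233
  e)) 203524421
  (n (n e 203526209
  e) 203530373
  e)) 203589761
  (n (n (n e 203591943
  e) 203654499
  (n e 203661443
  e)) 203852099
  (n (n e 203854085
  e) 204508257
  e))) 204508260
  (n (n (n (n e 204539041
  e) 204547173
  (n e 204606561
  e)) 204606759
  (n (n e 204637540
  e) 204645474
  e)) 204901668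
  (n (n (n e 205588994
  e) 205591587
  e) 205620577
  (n (n e 205629511
  e) 205654152
  e)))))) 205657313
  (n (n (n (n (n (n (n e 205686307
  e) 205695043
  (n e 205785220
  e)) 205788579
  (n (n e 207719529
  e) 207720705
  e)) 207752673
  (n (n (n e 207753290
  e) 207817827
  (n e 207818403
  e)) 207818820
  (n (n e 207819204
  e) 209782914
  e))) 209788069
  (n (n (n (n e 235997345
  e) 235997347
  (n e 235999329
  e)) 235999331
  (n (n e 236095875
  e) 236097634
  e)) 236161186
  (n (n (n e 236163396
  e) 237046914
  e) 237110466
  (n (n e 237118627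
  e) 237177992
  e)))) 237178209
  (n (n (n (n (n e 237309062
  e) 237309506
  (n e 238061730
  e)) 238064706
  (n (n e 238126275
  e) 238135426
  e)) 238193249
  (n (n (n e 238195784
  e) 238259010
  (n e 238261317
  e)) 239142082
  (n (n e 239152227
  e) 240159874
  e))) 240160867
  (n (n (n (n e 240223650
  e) 240234564
  (n e 240289957
  e)) 240294146
  (n (n e 243403908
  e) 243404354
  e)) 243405894
  (n (n (n e 243406115
  e) 244420710
  e) 244420930
  (n (n e 269585569
  e) 269585572
  e))))) 269749411
  (n (n (n (n (n (n e 269749667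
  e) 270600388
  (n e 270603361
  e)) 270698945
  (n (n e 270701671
  e) 270796994
  e)) 270797506
  (n (n (n e 270799973
  e) 270800229
  (n e 272698529
  e)) 272699526
  (n (n e 272730561
  e) 272734279
  e))) 272796355
  (n (n (n (n e 272799811
  e) 272829861
  (n e 272830594
  e)) 303139042
  (n (n e 303142018
  e) 305203425
  e)) 305207397
  (n (n (n e 305237190
  e) 305238177
  e) 305302020
  (n (n e 305305698
  e) 305433795
  e)))) 305435076
  (n (n (n (n (n e 307333634
  e) 307338308
  (n e 308350146
  e)) 308352132
  (n (n e 337742081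
  e) 337746053
  e)) 337775841
  (n (n (n e 337776838
  e) 337873475
  (n e 337877123
  e)) 337972771
  (n (n e 337973444
  e) 339806466
  e))) 339811427
  (n (n (n (n e 341938371
  e) 370314498
  (n e 370315491
  e)) 372345123
  (n (n e 372350082
  e) 373427460
  e)) 373429442
  (n (n (n e 404883778
  e) 404888739
  e) 438504770
  (n (n e 438506756
  e) 439554339
  e)))))))))

end Tr

theorem search_ok : search Tr.codes = true := by decide +kernel
theorem good_ok : Tr.codes.toList.all good = true := by decide +kernel
theorem incr_ok : incr 0 Tr.codes.toList = true := by decide +kernel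
theorem len_ok : Tr.codes.toList.length = 868 := by decide +kernel

/-- The states of a frieze. -/
def stateOf (x y z : ℤ → ℤ) (i : ℤ) : St :=
  ⟨(x i).toNat, (y i).toNat, (z i).toNat, (x (i + 1)).toNat, (y (i + 1)).toNat, (z (i + 1)).toNat⟩

theorem toNat_step {a b c d : ℤ} (ha : 1 ≤ a) (hb : 1 ≤ b) (hc : 0 ≤ c) (hd : 0 ≤ d)
    (h : a * b = c + d) :
    (c.toNat + d.toNat) % a.toNat = 0 ∧ (c.toNat + d.toNat) / a.toNat = b.toNat := by
  lift a to ℕ using by omega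
  lift b to ℕ using by omega
  lift c to ℕ using hc
  lift d to ℕ using hd
  simp only [Int.toNat_natCast]
  have h' : c + d = a * b := by exact_mod_cast h.symm
  rw [h']
  exact ⟨Nat.mul_mod_right a b, Nat.mul_div_cancel_left b (by omega)⟩

theorem FZ.step {x y z : ℤ → ℤ} (h : FZ x y z) (i : ℤ) :
    (stateOf x y z i).ok = true ∧ (stateOf x y z i).next = stateOf x y z (i + 1) := by
  have h1 := h.hx (i + 1)
  have h2 := h.hy (i + 1)
  have h3 := h.hz (i + 1)
  rw [show i + 1 - 1 = i by ring] at h1 h2 h3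
  have p1 := h.px (i + 1)
  have p2 := h.py (i + 1)
  have p3 := h.pz (i + 1)
  have t1 := toNat_step (h.px _) (h.px _) (by omega) (by omega) h1
  have t2 := toNat_step (h.py _) (h.py _) (by omega) (by positivity) h2
  have t3 := toNat_step (h.pz _) (h.pz _) (by omega) (by omega) h3
  rw [Int.toNat_mul (by omega) (by omega)] at t2
  constructor
  · simp only [St.ok, stateOf, Bool.and_eq_true, Nat.beq_eq]
    exact ⟨t1.1, t2.1, t3.1⟩
  · simp only [St.next, stateOf, St.mk.injEq, true_and]
    exact ⟨t1.2, t2.2, t3.2⟩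

theorem FZ.valid {x y z : ℤ → ℤ} (h : FZ x y z) (n : ℕ) :
    ∀ i, _root_.valid n (stateOf x y z i) = true := by
  induction n with
  | zero => intro i; rfl
  | succ n ih =>
    intro i
    simp only [_root_.valid, Bool.and_eq_true]
    exact ⟨(h.step i).1, by rw [(h.step i).2]; exact ih _⟩

theorem FZ.inTree {x y z : ℤ → ℤ} (h : FZ x y z) (t : Tr) (n : ℕ) :
    ∀ i, _root_.inTree t n (stateOf x y z i) = true → ∀ k : ℕ, k < n →
      (stateOf x y z (i + k)).small = true ∧ t.mem (stateOf x y z (i + k)).code = true := by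
  induction n with
  | zero => intro i _ k hk; omega
  | succ n ih =>
    intro i hi k hk
    simp only [_root_.inTree, Bool.and_eq_true] at hi
    rw [(h.step i).2] at hi
    cases k with
    | zero => simpa using hi.1
    | succ k =>
      have := ih _ hi.2 k (by omega)
      rw [show i + 1 + (k : ℤ) = i + ((k + 1 : ℕ) : ℤ) by push_cast; ring] at this
      exact this

theorem FZ.iter {x y z : ℤ → ℤ} (h : FZ x y z) (n : ℕ) :
    St.next^[n] (stateOf x y z 0) = stateOf x y z n := by
  induction n with
  | zero => rfl
  | succ n ih =>
    rw [Function.iterate_succ_apply', ih, (h.step _).2]; push_cast; rfl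

theorem dvd_range {a b N : ℤ} (ha : 1 ≤ a) (h : a * b = N) (hN : 1 ≤ N) (h40 : N < 40) :
    a.toNat < 40 ∧ N.toNat % a.toNat = 0 := by
  have hb : 1 ≤ b := by by_contra hh; nlinarith
  lift a to ℕ using by omega
  lift b to ℕ using by omega
  lift N to ℕ using by omega
  simp only [Int.toNat_natCast]
  have h' : N = a * b := by exact_mod_cast h.symm
  constructor
  · have : (a : ℤ) ≤ N := by nlinarith
    omega
  · rw [h']; exact Nat.mul_mod_right a b

theorem FZ.mem_of_one {x y z : ℤ → ℤ} (h : FZ x y z) (h0 : x 0 = 1) (k : ℕ) (hk : k < 14) :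
    (stateOf x y z k).small = true ∧ (stateOf x y z k).code ∈ Tr.codes.toList := by
  obtain ⟨p, r', t', hp, hs, hy, hr, ht⟩ := h.bounds h0
  have q1 := h.px 1
  have q0 := h.pz 0
  have hpq : 1 ≤ p * x 1 := by nlinarith
  have hN : z 0 + p * x 1 - 1 < 40 := by nlinarith [sq_nonneg (p - x 1)]
  have d1 := dvd_range (h.py 1) hr (by omega) hN
  have d2 := dvd_range (h.pz 1) ht (by omega) hN
  have hst : stateOf x y z 0 =
      ⟨1, p.toNat * (x 1).toNat - 1, (z 0).toNat, (x 1).toNat, (y 1).toNat, (z 1).toNat⟩ := by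
    simp only [stateOf, h0, hy, zero_add, St.mk.injEq, true_and, and_true]
    rw [← Int.toNat_mul (by omega) (by omega)]
    constructor
    · rfl
    · omega
  have hNn : (z 0 + p * x 1 - 1).toNat = (z 0).toNat + p.toNat * (x 1).toNat - 1 := by
    rw [← Int.toNat_mul (by omega) (by omega)]; omega
  have S := search_ok
  rw [search, List.all_eq_true] at S
  have S := S p.toNat (by rw [List.mem_range]; omega)
  rw [List.all_eq_true] at S
  have S := S (x 1).toNat (by rw [List.mem_range]; omega)
  rw [List.all_eq_true] at S
  have S := S (z 0).toNat (by rw [List.mem_range]; omega)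
  have c1 : (Nat.ble (p.toNat + (x 1).toNat + (z 0).toNat) 12 &&
      (Nat.ble 1 p.toNat && (Nat.ble 1 (x 1).toNat && Nat.ble 1 (z 0).toNat))) = true := by
    simp only [Bool.and_eq_true, Nat.ble_eq]; omega
  rw [c1, cond_true, List.all_eq_true] at S
  have S := S (y 1).toNat (List.mem_range.2 d1.1)
  rw [← hNn, d1.2, Nat.beq_refl, cond_true, List.all_eq_true] at S
  have S := S (z 1).toNat (List.mem_range.2 d2.1)
  rw [d2.2, Nat.beq_refl, cond_true, cand, ← hst, h.valid, cond_true] at S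
  have := h.inTree _ _ _ S k hk
  rw [zero_add] at this
  exact ⟨this.1, Tr.mem_toList _ _ this.2⟩

theorem stateOf_shift (x y z : ℤ → ℤ) (i k : ℤ) :
    stateOf (fun i => x (i + k)) (fun i => y (i + k)) (fun i => z (i + k)) i
      = stateOf x y z (i + k) := by
  simp only [stateOf]
  rw [show i + 1 + k = i + k + 1 by ring]

theorem FZ.mem {x y z : ℤ → ℤ} (h : FZ x y z) :
    (stateOf x y z 0).small = true ∧ (stateOf x y z 0).code ∈ Tr.codes.toList := by
  obtain ⟨i, hi⟩ := h.exists_one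
  have key := (h.shift i).mem_of_one (by simpa using hi) ((-i) % 14).toNat (by omega)
  rw [stateOf_shift] at key
  have e : ((((-i) % 14).toNat : ℕ) : ℤ) + i = 0 + 14 * (-((-i) / 14)) := by omega
  have e1 : ((((-i) % 14).toNat : ℕ) : ℤ) + i + 1 = 1 + 14 * (-((-i) / 14)) := by omega
  have : stateOf x y z ((((-i) % 14).toNat : ℕ) + i) = stateOf x y z 0 := by
    simp only [stateOf]
    rw [show (0 : ℤ) + 1 = 1 from rfl, e1, e]
    simp only [FZ.per_mul h.per, FZ.per_mul h.pery, FZ.per_mul h.swap.per]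
  rwa [this] at key

/-- The frieze with a given code. -/
def friezeOf (c : ℕ) (i : ℤ) (j : Fin 5) : ℤ :=
  ![1, ((St.next^[(i % 14).toNat] (decode c)).x : ℤ), ((St.next^[(i % 14).toNat] (decode c)).y : ℤ),
    ((St.next^[(i % 14).toNat] (decode c)).z : ℤ), 1] j

theorem goodRun_iter (n : ℕ) : ∀ s : St, goodRun n s = true → ∀ k, k < n →
    (St.next^[k] s).pos = true ∧ (St.next^[k] s).ok = true := by
  induction n with
  | zero => intro s _ k hk; omega
  | succ n ih =>
    intro s hs k hk
    simp only [goodRun, Bool.and_eq_true] at hs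
    cases k with
    | zero => exact hs.1
    | succ k => exact ih _ hs.2 k (by omega)

theorem friezeOf_spec (c : ℕ) (hc : good c = true) : Is2Frieze 3 (friezeOf c) := by
  simp only [good, Bool.and_eq_true, Nat.beq_eq] at hc
  obtain ⟨hs, hr, hcode, hs', hcode'⟩ := hc
  have hper : St.next^[14] (decode c) = decode c := by
    rw [← decode_code _ hs', hcode']
  have hmod : ∀ n : ℕ, St.next^[n % 14] (decode c) = St.next^[n] (decode c) := by
    intro n
    conv_rhs => rw [← Nat.mod_add_div n 14, Function.iterate_add_apply, Function.iterate_mul]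
    rw [Function.iterate_fixed hper]
  have hrun : ∀ n : ℕ, (St.next^[n] (decode c)).pos = true ∧ (St.next^[n] (decode c)).ok = true := by
    intro n
    rw [← hmod]
    exact goodRun_iter 14 _ hr _ (Nat.mod_lt _ (by norm_num))
  have key : ∀ i : ℤ, ∃ s : St, s.pos = true ∧ s.ok = true ∧ s.next.pos = true ∧
      St.next^[((i - 1) % 14).toNat] (decode c) = s ∧
      St.next^[(i % 14).toNat] (decode c) = s.next ∧
      St.next^[((i + 1) % 14).toNat] (decode c) = s.next.next := by
    intro i
    refine ⟨_, (hrun _).1, (hrun _).2, ?_, rfl, ?_, ?_⟩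
    · rw [← Function.iterate_succ_apply' St.next]; exact (hrun _).1
    · rw [← Function.iterate_succ_apply' St.next, ← hmod (((i - 1) % 14).toNat.succ)]
      congr 1; omega
    · rw [← Function.iterate_succ_apply' St.next, ← Function.iterate_succ_apply' St.next,
        ← hmod (((i - 1) % 14).toNat.succ.succ)]
      congr 1; omega
  refine ⟨fun i => rfl, fun i => rfl, ?_, ?_⟩
  · intro i j h1 h2
    obtain ⟨s, hp, ho, hp', -, e2, -⟩ := key i
    simp only [St.pos, Bool.and_eq_true, Nat.ble_eq] at hp'
    interval_cases j
    · change 1 ≤ ((St.next^[(i % 14).toNat] (decode c)).x : ℤ)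
      rw [e2]; omega
    · change 1 ≤ ((St.next^[(i % 14).toNat] (decode c)).y : ℤ)
      rw [e2]; omega
    · change 1 ≤ ((St.next^[(i % 14).toNat] (decode c)).z : ℤ)
      rw [e2]; omega
  · intro i j h1 h2
    obtain ⟨s, hp, ho, hp', e1, e2, e3⟩ := key i
    simp only [St.ok, Bool.and_eq_true, Nat.beq_eq] at ho
    have m1 := Nat.mul_div_cancel' (Nat.dvd_of_mod_eq_zero ho.1)
    have m2 := Nat.mul_div_cancel' (Nat.dvd_of_mod_eq_zero ho.2.1)
    have m3 := Nat.mul_div_cancel' (Nat.dvd_of_mod_eq_zero ho.2.2)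
    interval_cases j
    · change ((St.next^[(i % 14).toNat] (decode c)).x : ℤ) =
        ((St.next^[((i - 1) % 14).toNat] (decode c)).x : ℤ) *
          ((St.next^[((i + 1) % 14).toNat] (decode c)).x : ℤ) -
        1 * ((St.next^[(i % 14).toNat] (decode c)).y : ℤ)
      rw [e1, e2, e3]
      simp only [St.next]
      zify at m1
      push_cast
      linarith
    · change ((St.next^[(i % 14).toNat] (decode c)).y : ℤ) =
        ((St.next^[((i - 1) % 14).toNat] (decode c)).y : ℤ) *
          ((St.next^[((i + 1) % 14).toNat] (decode c)).y : ℤ) -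
        ((St.next^[(i % 14).toNat] (decode c)).x : ℤ) *
          ((St.next^[(i % 14).toNat] (decode c)).z : ℤ)
      rw [e1, e2, e3]
      simp only [St.next]
      zify at m2
      push_cast
      linarith
    · change ((St.next^[(i % 14).toNat] (decode c)).z : ℤ) =
        ((St.next^[((i - 1) % 14).toNat] (decode c)).z : ℤ) *
          ((St.next^[((i + 1) % 14).toNat] (decode c)).z : ℤ) -
        ((St.next^[(i % 14).toNat] (decode c)).y : ℤ) * 1
      rw [e1, e2, e3]
      simp only [St.next]
      zify at m3
      push_cast
      linarith

theorem toFZ {a : ℤ → Fin 5 → ℤ} (h : Is2Frieze 3 a) :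
    FZ (fun i => a i 1) (fun i => a i 2) (fun i => a i 3) := by
  obtain ⟨h0, h4, hp, hr⟩ := h
  refine ⟨fun i => hp i 1 (by norm_num) (by norm_num), fun i => hp i 2 (by norm_num) (by norm_num),
    fun i => hp i 3 (by norm_num) (by norm_num), fun i => ?_, fun i => ?_, fun i => ?_⟩
  · have e := hr i 1 (by norm_num) (by norm_num)
    have e0 := h0 i
    change a i 1 = a (i - 1) 1 * a (i + 1) 1 - a i 0 * a i 2 at e
    change a i 0 = 1 at e0
    rw [e0] at e
    linarith
  · have e := hr i 2 (by norm_num) (by norm_num)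
    change a i 2 = a (i - 1) 2 * a (i + 1) 2 - a i 1 * a i 3 at e
    linarith
  · have e := hr i 3 (by norm_num) (by norm_num)
    have e0 := h4 i
    change a i 3 = a (i - 1) 3 * a (i + 1) 3 - a i 2 * a i 4 at e
    change a i 4 = 1 at e0
    rw [e0] at e
    linarith

theorem eq_friezeOf {a : ℤ → Fin 5 → ℤ} (h : Is2Frieze 3 a) :
    ∃ c ∈ Tr.codes.toList, friezeOf c = a := by
  have hf := toFZ h
  obtain ⟨hs, hm⟩ := hf.mem
  refine ⟨_, hm, ?_⟩
  funext i j
  have em : (((i % 14).toNat : ℕ) : ℤ) = i + 14 * (-(i / 14)) := by omega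
  have e1 := FZ.per_mul (f := fun i => a i 1) hf.per i (-(i / 14))
  have e2 := FZ.per_mul (f := fun i => a i 2) hf.pery i (-(i / 14))
  have e3 := FZ.per_mul (f := fun i => a i 3) hf.swap.per i (-(i / 14))
  have p1 := hf.px i
  have p2 := hf.py i
  have p3 := hf.pz i
  simp only [friezeOf]
  rw [decode_code _ hs, hf.iter, em]
  simp only [stateOf, e1, e2, e3]
  fin_cases j
  · exact (h.1 i).symm
  · exact Int.toNat_of_nonneg (by omega)
  · exact Int.toNat_of_nonneg (by omega)
  · exact Int.toNat_of_nonneg (by omega)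
  · exact (h.2.1 i).symm

theorem friezeOf_inj {c d : ℕ} (hc : good c = true) (hd : good d = true)
    (h : friezeOf c = friezeOf d) : c = d := by
  simp only [good, Bool.and_eq_true, Nat.beq_eq] at hc hd
  have f : ∀ i j, friezeOf c i j = friezeOf d i j := fun i j => by rw [h]
  have a1 : ((decode c).x : ℤ) = (decode d).x := f 0 1
  have a2 : ((decode c).y : ℤ) = (decode d).y := f 0 2
  have a3 : ((decode c).z : ℤ) = (decode d).z := f 0 3
  have a4 : ((decode c).u : ℤ) = (decode d).u := f 1 1
  have a5 : ((decode c).v : ℤ) = (decode d).v := f 1 2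
  have a6 : ((decode c).w : ℤ) = (decode d).w := f 1 3
  rw [← hc.2.2.1, ← hd.2.2.1]
  simp only [St.code]
  omega

theorem set_eq : {a : ℤ → Fin 5 → ℤ | Is2Frieze 3 a} =
    friezeOf '' (Tr.codes.toList.toFinset : Set ℕ) := by
  ext a
  simp only [Set.mem_ofPred_eq, Set.mem_image, List.coe_toFinset]
  constructor
  · intro h
    exact eq_friezeOf h
  · rintro ⟨c, hc, rfl⟩
    exact friezeOf_spec c (List.all_eq_true.1 good_ok c hc)

theorem statement8 :
    {a : ℤ → Fin 5 → ℤ | Is2Frieze 3 a}.Finite ∧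
    {a : ℤ → Fin 5 → ℤ | Is2Frieze 3 a}.ncard = 868 := by
  rw [set_eq]
  refine ⟨(Finset.finite_toSet _).image _, ?_⟩
  rw [Set.ncard_image_of_injOn, Set.ncard_coe_finset,
    List.toFinset_card_of_nodup (incr_nodup _ _ incr_ok), len_ok]
  intro c hc d hd h
  simp only [List.coe_toFinset, Set.mem_ofPred_eq] at hc hd
  exact friezeOf_inj (List.all_eq_true.1 good_ok c hc) (List.all_eq_true.1 good_ok d hd) h
end
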